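/- arXiv:1503.02712 — 2 statements merged into one kernel-verified Lean document; each statement's English description precedes it below -/
import Mathlib

section
/- Nonlinear integration by parts identity for the scaling generator: let p > 1 and define Λf(y) = (2/(p-1)) f(y) + y f'(y). Let ε : ℝ → ℝ be C¹ with compact support, let Q : ℝ → ℝ be C¹ with Q(y) > 0 for all y, and let ψ : ℝ → ℝ be C¹. Then ∫_ℝ Λε · ψ · [ (ε+Q)|ε+Q|^{p-1} − Q^p ] dy = (1/(p+1)) ∫_ℝ ( ((p+3)/(p-1)) ψ − y ψ' ) · [ |Q+ε|^{p+1} − Q^{p+1} − (p+1) ε Q^p ] dy − ∫_ℝ ψ · ΛQ · [ (ε+Q)|ε+Q|^{p-1} − Q^p − p ε Q^{p-1} ] dy. -/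
open MeasureTheory

/-- The signed power `u |u|^(p-1)` times `u` is `|u|^(p+1)`. -/
lemma abs_rpow_add_one_eq {p : ℝ} (hp : 1 < p) (u : ℝ) :
    |u| ^ (p + 1) = u * (u * |u| ^ (p - 1)) := by
  rcases eq_or_ne u 0 with rfl | hu
  · simp [Real.zero_rpow (by linarith : p + 1 ≠ 0)]
  · rw [show p + 1 = (p - 1) + (2 : ℕ) by push_cast; ring,
      Real.rpow_add_natCast (abs_pos.mpr hu).ne', sq_abs]
    ring

/-- The derivative of `|u|^(p+1)` along a curve is `(p+1) u |u|^(p-1) u'`. -/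
lemma HasDerivAt.abs_rpow_add_one {p : ℝ} (hp : 1 < p) {u : ℝ → ℝ} {u' y : ℝ}
    (hu : HasDerivAt u u' y) :
    HasDerivAt (fun z => |u z| ^ (p + 1)) ((p + 1) * (u y * |u y| ^ (p - 1)) * u') y := by
  have h := (hasDerivAt_abs_rpow (u y) (by linarith : 1 < p + 1)).comp y hu
  rw [show p + 1 - 2 = p - 1 by ring] at h
  exact h.congr_deriv (by ring)

/-- The derivative of the second-order Taylor remainder of `|·|^(p+1)` at `Q` in the
direction `ε`, along curves. -/
lemma hasDerivAt_abs_rpow_taylor_remainder {p : ℝ} (hp : 1 < p) {ε Q : ℝ → ℝ} {ε' Q' y : ℝ}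
    (hε : HasDerivAt ε ε' y) (hQ : HasDerivAt Q Q' y) (hQpos : 0 < Q y) :
    HasDerivAt (fun z => |Q z + ε z| ^ (p + 1) - Q z ^ (p + 1) - (p + 1) * ε z * Q z ^ p)
      ((p + 1) * (ε' * ((ε y + Q y) * |ε y + Q y| ^ (p - 1) - Q y ^ p) +
        Q' * ((ε y + Q y) * |ε y + Q y| ^ (p - 1) - Q y ^ p - p * ε y * Q y ^ (p - 1)))) y := by
  have h1 := (hQ.add hε).abs_rpow_add_one hp
  have h2 := hQ.rpow_const (p := p + 1) (Or.inl hQpos.ne')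
  have h3 := (hε.const_mul (p + 1)).mul (hQ.rpow_const (p := p) (Or.inl hQpos.ne'))
  refine ((h1.sub h2).sub h3).congr_deriv ?_
  simp only [Pi.add_apply, add_sub_cancel_right, add_comm (Q y) (ε y)]
  ring

/-- Nonlinear integration by parts identity for the scaling generator
`Λf = (2/(p-1)) f + y f'` (identity (5.36) of the paper). -/
theorem stmt_17 (p : ℝ) (hp : 1 < p) (ε Q ψ : ℝ → ℝ)
    (hε : ContDiff ℝ 1 ε) (hεc : HasCompactSupport ε)
    (hQ : ContDiff ℝ 1 Q) (hQpos : ∀ y : ℝ, 0 < Q y)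
    (hψ : ContDiff ℝ 1 ψ) :
    (∫ y : ℝ, ((2 / (p - 1)) * ε y + y * deriv ε y) * ψ y *
        ((ε y + Q y) * |ε y + Q y| ^ (p - 1) - Q y ^ p))
      = (1 / (p + 1)) * (∫ y : ℝ, (((p + 3) / (p - 1)) * ψ y - y * deriv ψ y) *
            (|Q y + ε y| ^ (p + 1) - Q y ^ (p + 1) - (p + 1) * ε y * Q y ^ p))
        - ∫ y : ℝ, ψ y * ((2 / (p - 1)) * Q y + y * deriv Q y) *
            ((ε y + Q y) * |ε y + Q y| ^ (p - 1) - Q y ^ p - p * ε y * Q y ^ (p - 1)) := by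
  have hp1 : p - 1 ≠ 0 := by linarith
  have hp2 : p + 1 ≠ 0 := by linarith
  have cε := hε.continuous
  have cQ := hQ.continuous
  have cψ := hψ.continuous
  have cε' : Continuous (deriv ε) := hε.continuous_deriv le_rfl
  have cQ' : Continuous (deriv Q) := hQ.continuous_deriv le_rfl
  have cψ' : Continuous (deriv ψ) := hψ.continuous_deriv le_rfl
  have dε (y : ℝ) : HasDerivAt ε (deriv ε y) y := (hε.differentiable one_ne_zero y).hasDerivAt
  have dQ (y : ℝ) : HasDerivAt Q (deriv Q y) y := (hQ.differentiable one_ne_zero y).hasDerivAt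
  have dψ (y : ℝ) : HasDerivAt ψ (deriv ψ y) y := (hψ.differentiable one_ne_zero y).hasDerivAt
  have cpow (r : ℝ) : Continuous (fun y => Q y ^ r) :=
    cQ.rpow_const fun y => Or.inl (hQpos y).ne'
  have cabs : Continuous (fun y => |ε y + Q y| ^ (p - 1)) :=
    (cε.add cQ).abs.rpow_const fun y => Or.inr (by linarith)
  have hQQ (y : ℝ) : Q y * Q y ^ (p - 1) = Q y ^ p := by
    rw [mul_comm, ← Real.rpow_add_one (hQpos y).ne', sub_add_cancel]
  have hQQ' (y : ℝ) : Q y ^ (p + 1) = Q y * Q y ^ p := by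
    rw [Real.rpow_add_one (hQpos y).ne', mul_comm]
  set A : ℝ → ℝ := fun y => (ε y + Q y) * |ε y + Q y| ^ (p - 1) - Q y ^ p with hA
  set B : ℝ → ℝ := fun y =>
    (ε y + Q y) * |ε y + Q y| ^ (p - 1) - Q y ^ p - p * ε y * Q y ^ (p - 1) with hB
  set F : ℝ → ℝ := fun y =>
    |Q y + ε y| ^ (p + 1) - Q y ^ (p + 1) - (p + 1) * ε y * Q y ^ p with hF
  have cA : Continuous A := ((cε.add cQ).mul cabs).sub (cpow p)
  have cB : Continuous B := cA.sub ((continuous_const.mul cε).mul (cpow (p - 1)))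
  have dF (y : ℝ) : HasDerivAt F ((p + 1) * (deriv ε y * A y + deriv Q y * B y)) y :=
    hasDerivAt_abs_rpow_taylor_remainder hp (dε y) (dQ y) (hQpos y)
  have cF : Continuous F := continuous_iff_continuousAt.mpr fun y => (dF y).continuousAt
  have hFAB (y : ℝ) : F y = ε y * A y + Q y * B y := by
    simp only [hF, hA, hB, abs_rpow_add_one_eq hp, hQQ', add_comm (Q y) (ε y)]
    linear_combination p * ε y * hQQ y
  have zA (y : ℝ) (h : ε y = 0) : A y = 0 := by
    simp only [hA, h, zero_add, abs_of_pos (hQpos y), hQQ, sub_self]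
  have zB (y : ℝ) (h : ε y = 0) : B y = 0 := by
    simp only [hB, h, zero_add, abs_of_pos (hQpos y), hQQ, mul_zero, zero_mul, sub_self]
  have zF (y : ℝ) (h : ε y = 0) : F y = 0 := by
    rw [hFAB, zA y h, zB y h, mul_zero, mul_zero, add_zero]
  have integrable_mul {g G : ℝ → ℝ} (cg : Continuous g) (cG : Continuous G)
      (zG : ∀ y, ε y = 0 → G y = 0) : Integrable (fun y => g y * G y) :=
    (cg.mul cG).integrable_of_hasCompactSupport <|
      HasCompactSupport.mul_left <| hεc.mono fun y hy h => hy (zG y h)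
  have iL : Integrable fun y => ((2 / (p - 1)) * ε y + y * deriv ε y) * ψ y * A y :=
    integrable_mul (by fun_prop) cA zA
  have iM : Integrable fun y => (((p + 3) / (p - 1)) * ψ y - y * deriv ψ y) * F y :=
    integrable_mul (by fun_prop) cF zF
  have iN : Integrable fun y => ψ y * ((2 / (p - 1)) * Q y + y * deriv Q y) * B y :=
    integrable_mul (by fun_prop) cB zB
  have iMN : Integrable fun y =>
      (1 / (p + 1)) * ((((p + 3) / (p - 1)) * ψ y - y * deriv ψ y) * F y)
        - ψ y * ((2 / (p - 1)) * Q y + y * deriv Q y) * B y :=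
    (iM.const_mul _).sub iN
  have hzero := integral_eq_zero_of_hasDerivAt_of_integrable
    (f := fun y => y * ψ y * F y)
    (f' := fun y => (p + 1) * (((2 / (p - 1)) * ε y + y * deriv ε y) * ψ y * A y
      - ((1 / (p + 1)) * ((((p + 3) / (p - 1)) * ψ y - y * deriv ψ y) * F y)
        - ψ y * ((2 / (p - 1)) * Q y + y * deriv Q y) * B y)))
    (fun y => by
      refine (((hasDerivAt_id y).mul (dψ y)).mul (dF y)).congr_deriv ?_
      simp only [Pi.mul_apply, id_eq]
      rw [hFAB]
      field_simp
      ring)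
    ((iL.sub iMN).const_mul _)
    (integrable_mul (by fun_prop) cF zF)
  rw [integral_const_mul, integral_sub iL iMN,
    integral_sub (iM.const_mul _) iN, integral_const_mul] at hzero
  exact sub_eq_zero.mp ((mul_eq_zero.mp hzero).resolve_left hp2)
end

section
/- Coercivity of the linearized operator under three orthogonality conditions (Lemma A.1 of the paper, quadratic-form version): there exists p* > 5 such that for every p ∈ [5, p*) there exists a constant κ₀ > 0 with the following property. Let Q_p(y) = ((p+1)/2)^{1/(p-1)} (cosh((p-1)y/2))^{-2/(p-1)} and ΛQ_p(y) = (2/(p-1)) Q_p(y) + y Q_p'(y). Then for every continuously differentiable f : ℝ → ℝ such that f² and (f')² are integrable on ℝ, one has ∫_ℝ ( f'(y)² + f(y)² − p Q_p(y)^{p-1} f(y)² ) dy ≥ κ₀ ∫_ℝ ( f'(y)² + f(y)² ) dy − κ₀^{-1} [ ( ∫_ℝ f Q_p )² + ( ∫_ℝ f ΛQ_p )² + ( ∫_ℝ f(y) · y ΛQ_p(y) dy )² ]. -/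
open MeasureTheory

/-- The explicit ground state profile
`Q_p(y) = ((p+1)/2)^{1/(p-1)} (cosh((p-1)y/2))^{-2/(p-1)}`. -/
noncomputable def Qp (p y : ℝ) : ℝ :=
  ((p + 1) / 2) ^ (1 / (p - 1)) * (Real.cosh ((p - 1) * y / 2)) ^ (-(2 / (p - 1)))

/-- The scaling generator applied to the ground state: `ΛQ_p = (2/(p-1)) Q_p + y Q_p'`. -/
noncomputable def LamQp (p y : ℝ) : ℝ :=
  (2 / (p - 1)) * Qp p y + y * deriv (Qp p) y

open MeasureTheory Set Filter Topology

/-! ### Square-integrable functions -/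

theorem sq_integral_mul_le {α : Type*} [MeasurableSpace α] {μ : Measure α} {f g : α → ℝ}
    (hf : MemLp f 2 μ) (hg : MemLp g 2 μ) :
    (∫ x, f x * g x ∂μ) ^ 2 ≤ (∫ x, f x ^ 2 ∂μ) * ∫ x, g x ^ 2 ∂μ := by
  have hfg : Integrable (fun x => f x * g x) μ := hf.integrable_mul hg
  have key : ∀ t : ℝ, 0 ≤ (∫ x, g x ^ 2 ∂μ) * (t * t) + (2 * ∫ x, f x * g x ∂μ) * t
      + ∫ x, f x ^ 2 ∂μ := by
    intro t
    have h : 0 ≤ ∫ x, (f x + t * g x) ^ 2 ∂μ := integral_nonneg fun x => sq_nonneg _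
    have e : ∀ x, (f x + t * g x) ^ 2 = (t * t) * g x ^ 2 + (2 * t) * (f x * g x) + f x ^ 2 :=
      fun x => by ring
    simp_rw [e] at h
    have hsum : Integrable (fun x => (t * t) * g x ^ 2 + (2 * t) * (f x * g x)) μ :=
      (hg.integrable_sq.const_mul _).add (hfg.const_mul _)
    rw [integral_add hsum hf.integrable_sq,
      integral_add (hg.integrable_sq.const_mul _) (hfg.const_mul _), integral_const_mul,
      integral_const_mul] at h
    linarith
  have := discrim_le_zero key
  rw [discrim] at this
  nlinarith

theorem integral_Ioi_deriv_eq_neg {H H' : ℝ → ℝ} {a : ℝ}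
    (hH : ∀ y ∈ Ici a, HasDerivAt H (H' y) y) (hi : IntegrableOn H' (Ioi a))
    (h : IntegrableOn H (Ioi a)) : ∫ y in Ioi a, H' y = - H a := by
  have ht := tendsto_zero_of_hasDerivAt_of_integrableOn_Ioi
    (fun x hx => hH x (Ioi_subset_Ici_self hx)) hi h
  rw [integral_Ioi_of_hasDerivAt_of_tendsto' hH hi ht, zero_sub]

/-- Riccati lower bound for a Dirichlet form on a half-line. -/
theorem mul_integral_sq_le_of_riccati_Ioi {r r' η η' W : ℝ → ℝ} {a κ C : ℝ}
    (hr : ∀ y, HasDerivAt r (r' y) y)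
    (hr2 : MemLp r 2 (volume.restrict (Ioi a))) (hr2' : MemLp r' 2 (volume.restrict (Ioi a)))
    (hη : ∀ y ∈ Ici a, HasDerivAt η (η' y) y) (hη' : ContinuousOn η' (Ici a))
    (hW : Continuous W)
    (bη : ∀ y ∈ Ici a, |η y| ≤ C) (bη' : ∀ y ∈ Ici a, |η' y| ≤ C) (bW : ∀ y ∈ Ici a, |W y| ≤ C)
    (hric : ∀ y ∈ Ici a, η' y + η y ^ 2 + κ ≤ W y) (ha : r a = 0) :
    κ * ∫ y in Ioi a, r y ^ 2 ≤ ∫ y in Ioi a, (r' y ^ 2 + W y * r y ^ 2) := by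
  have mη : ContinuousOn η (Ioi a) := fun y hy =>
    (hη y (Ioi_subset_Ici_self hy)).continuousAt.continuousWithinAt
  have mul2 : ∀ {g : ℝ → ℝ}, ContinuousOn g (Ioi a) → (∀ y ∈ Ici a, |g y| ≤ C) →
      MemLp (fun y => g y * r y) 2 (volume.restrict (Ioi a)) := by
    intro g hg hb
    refine hr2.of_le_mul (c := C)
      ((hg.aestronglyMeasurable measurableSet_Ioi).mul hr2.aestronglyMeasurable) ?_
    filter_upwards [ae_restrict_mem measurableSet_Ioi] with y hy
    rw [Real.norm_eq_abs, Real.norm_eq_abs, abs_mul]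
    exact mul_le_mul_of_nonneg_right (hb y (Ioi_subset_Ici_self hy)) (abs_nonneg _)
  have L1 := mul2 mη bη
  have L2 := mul2 (hη'.mono Ioi_subset_Ici_self) bη'
  have L3 := mul2 hW.continuousOn bW
  have i1 : IntegrableOn (fun y => η y * r y * r y) (Ioi a) := L1.integrable_mul hr2
  have i2 : IntegrableOn (fun y => η' y * r y * r y) (Ioi a) := L2.integrable_mul hr2
  have i3 : IntegrableOn (fun y => W y * r y * r y) (Ioi a) := L3.integrable_mul hr2
  have i4 : IntegrableOn (fun y => η y * r y * r' y) (Ioi a) := L1.integrable_mul hr2'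
  have hd : IntegrableOn (fun y => η' y * r y * r y + 2 * (η y * r y * r' y)) (Ioi a) :=
    i2.add (i4.const_mul 2)
  have hz : ∫ y in Ioi a, (η' y * r y * r y + 2 * (η y * r y * r' y)) = 0 := by
    rw [integral_Ioi_deriv_eq_neg (H := fun y => η y * r y * r y) _ hd i1, ha]
    · simp
    · intro y hy
      exact (((hη y hy).mul (hr y)).mul (hr y)).congr_deriv (by simp only [Pi.mul_apply]; ring)
  have hQ : IntegrableOn (fun y => r' y ^ 2 + W y * r y ^ 2) (Ioi a) :=
    hr2'.integrable_sq.add (i3.congr (Eventually.of_forall fun y => by simp only; ring))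
  have h1 : ∫ y in Ioi a, (κ * r y ^ 2 + (η' y * r y * r y + 2 * (η y * r y * r' y)))
      ≤ ∫ y in Ioi a, (r' y ^ 2 + W y * r y ^ 2) := by
    refine setIntegral_mono_on ((hr2.integrable_sq.const_mul κ).add hd) hQ measurableSet_Ioi ?_
    intro y hy
    nlinarith [sq_nonneg (r' y - η y * r y), mul_nonneg (sq_nonneg (r y))
      (sub_nonneg.2 (hric y (Ioi_subset_Ici_self hy)))]
  rwa [integral_add (hr2.integrable_sq.const_mul κ) hd, hz, add_zero, integral_const_mul] at h1

/-- Riccati lower bound for a Dirichlet form on a bounded interval. -/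
theorem mul_integral_sq_le_of_riccati_Ioc {r r' η η' W : ℝ → ℝ} {a b κ : ℝ} (hab : a ≤ b)
    (hr : ∀ y, HasDerivAt r (r' y) y) (hr' : Continuous r')
    (hη : ∀ y, HasDerivAt η (η' y) y) (hη' : Continuous η') (hW : Continuous W)
    (hric : ∀ y ∈ Icc a b, η' y + η y ^ 2 + κ ≤ W y) (ha : r a = 0) (hb : r b = 0) :
    κ * ∫ y in Ioc a b, r y ^ 2 ≤ ∫ y in Ioc a b, (r' y ^ 2 + W y * r y ^ 2) := by
  have cr : Continuous r := continuous_iff_continuousAt.2 fun y => (hr y).continuousAt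
  have cη : Continuous η := continuous_iff_continuousAt.2 fun y => (hη y).continuousAt
  rw [← intervalIntegral.integral_of_le hab, ← intervalIntegral.integral_of_le hab]
  have hd : Continuous (fun y => η' y * r y * r y + 2 * (η y * r y * r' y)) := by fun_prop
  have hz : ∫ y in a..b, (η' y * r y * r y + 2 * (η y * r y * r' y)) = 0 := by
    rw [intervalIntegral.integral_eq_sub_of_hasDerivAt (f := fun y => η y * r y * r y)
      (fun y _ => (((hη y).mul (hr y)).mul (hr y)).congr_deriv (by simp only [Pi.mul_apply]; ring))
      (hd.intervalIntegrable _ _), ha, hb]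
    simp
  have c2 : Continuous (fun y => κ * r y ^ 2) := by fun_prop
  have h1 : ∫ y in a..b, (κ * r y ^ 2 + (η' y * r y * r y + 2 * (η y * r y * r' y)))
      ≤ ∫ y in a..b, (r' y ^ 2 + W y * r y ^ 2) := by
    refine intervalIntegral.integral_mono_on hab ((c2.add hd).intervalIntegrable _ _)
      (Continuous.intervalIntegrable (by fun_prop) _ _) ?_
    intro y hy
    nlinarith [sq_nonneg (r' y - η y * r y), mul_nonneg (sq_nonneg (r y))
      (sub_nonneg.2 (hric y hy))]
  rwa [intervalIntegral.integral_add (c2.intervalIntegrable _ _) (hd.intervalIntegrable _ _), hz,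
    add_zero, intervalIntegral.integral_const_mul] at h1

/-! ### The potential at the critical exponent -/

theorem hasDerivAt_tanh_mul (k y : ℝ) :
    HasDerivAt (fun y => Real.tanh (k * y)) (k * (1 - Real.tanh (k * y) ^ 2)) y := by
  have hc : Real.cosh (k * y) ≠ 0 := (Real.cosh_pos _).ne'
  have hl : HasDerivAt (fun y => k * y) k y := by simpa using (hasDerivAt_id y).const_mul k
  have h := (hl.sinh).div (hl.cosh) hc
  have e : (fun y => Real.tanh (k * y))
      = (fun y => Real.sinh (k * y)) / fun y => Real.cosh (k * y) :=
    funext fun y => Real.tanh_eq_sinh_div_cosh _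
  rw [e]
  refine h.congr_deriv ?_
  rw [Real.tanh_eq_sinh_div_cosh]
  field_simp

theorem continuous_tanh_mul (k : ℝ) : Continuous fun y => Real.tanh (k * y) :=
  continuous_iff_continuousAt.2 fun y => (hasDerivAt_tanh_mul k y).continuousAt

theorem exists_tanh_two_mul_eq : ∃ a : ℝ, 0 < a ∧ Real.tanh (2 * a) = 9 / 20 := by
  refine ⟨Real.artanh (9 / 20) / 2, ?_, ?_⟩
  · have := Real.artanh_pos (x := 9 / 20) ⟨by norm_num, by norm_num⟩
    linarith
  · rw [mul_div_cancel₀ _ (two_ne_zero), Real.tanh_artanh ⟨by norm_num, by norm_num⟩]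

theorem tanh_mono {x y : ℝ} (h : x ≤ y) : Real.tanh x ≤ Real.tanh y := by
  rw [← Real.artanh_le_artanh_iff ⟨Real.neg_one_lt_tanh x, Real.tanh_lt_one x⟩
    ⟨Real.neg_one_lt_tanh y, Real.tanh_lt_one y⟩, Real.artanh_tanh, Real.artanh_tanh]
  exact h

theorem integrable_form {μ : Measure ℝ} {r r' : ℝ → ℝ} (hr : MemLp r 2 μ) (hr' : MemLp r' 2 μ) :
    Integrable (fun y => r' y ^ 2 + (15 * Real.tanh (2 * y) ^ 2 - 14) * r y ^ 2) μ := by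
  have cT := continuous_tanh_mul 2
  have hW : MemLp (fun y => (15 * Real.tanh (2 * y) ^ 2 - 14) * r y) 2 μ := by
    refine hr.of_le_mul (c := 14)
      ((Continuous.aestronglyMeasurable (by fun_prop)).mul hr.aestronglyMeasurable) ?_
    refine Eventually.of_forall fun y => ?_
    rw [Real.norm_eq_abs, Real.norm_eq_abs, abs_mul]
    refine mul_le_mul_of_nonneg_right ?_ (abs_nonneg _)
    have := Real.tanh_sq_lt_one (2 * y)
    rw [abs_le]
    constructor <;> nlinarith [sq_nonneg (Real.tanh (2 * y))]
  exact hr'.integrable_sq.add ((hW.integrable_mul hr).congr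
    (Eventually.of_forall fun y => by simp only [Pi.mul_apply]; ring))

/-- The form of `-∂² + 1 - 15 sech²(2y)` on `(0, ∞)` is coercive on functions vanishing at `0` and
at the point `a` with `tanh (2 a) = 9 / 20`. -/
theorem dirichlet_coercive {r r' : ℝ → ℝ} {a : ℝ} (ha : 0 < a) (hta : Real.tanh (2 * a) = 9 / 20)
    (hr : ∀ y, HasDerivAt r (r' y) y) (hr' : Continuous r')
    (hr2 : MemLp r 2 (volume.restrict (Ioi 0))) (hr2' : MemLp r' 2 (volume.restrict (Ioi 0)))
    (h0 : r 0 = 0) (h1 : r a = 0) :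
    1 / 20 * ∫ y in Ioi 0, r y ^ 2
      ≤ ∫ y in Ioi 0, (r' y ^ 2 + (15 * Real.tanh (2 * y) ^ 2 - 14) * r y ^ 2) := by
  have cT : Continuous fun y => Real.tanh (2 * y) := continuous_tanh_mul 2
  have cr : Continuous r := continuous_iff_continuousAt.2 fun y => (hr y).continuousAt
  have hsub : Ioi a ⊆ Ioi (0 : ℝ) := Ioi_subset_Ioi ha.le
  have tlt : ∀ y, Real.tanh (2 * y) < 1 := fun y => Real.tanh_lt_one _
  have left := mul_integral_sq_le_of_riccati_Ioc (r := r) (r' := r') (κ := 1 / 20)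
    (η := fun y => 2 * (2 - 8 * Real.tanh (2 * y)))
    (η' := fun y => 2 * (-8 * (2 * (1 - Real.tanh (2 * y) ^ 2))))
    (W := fun y => 15 * Real.tanh (2 * y) ^ 2 - 14) ha.le hr hr'
    (fun y => by
      have := (((hasDerivAt_tanh_mul 2 y).const_mul 8).const_sub 2).const_mul 2
      exact this.congr_deriv (by ring))
    (by fun_prop) (by fun_prop) (by
      intro y hy
      have t0 : 0 ≤ Real.tanh (2 * y) := by
        have := tanh_mono (x := 0) (y := 2 * y) (by linarith [hy.1])
        simpa using this
      have t1 : Real.tanh (2 * y) ≤ 9 / 20 := hta ▸ tanh_mono (by linarith [hy.2])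
      nlinarith [mul_nonneg t0 (sub_nonneg.2 t1)]) h0 h1
  have tlow : ∀ y ∈ Ici a, 9 / 20 ≤ Real.tanh (2 * y) := fun y hy =>
    hta ▸ tanh_mono (by linarith [mem_Ici.1 hy])
  have slow : ∀ y ∈ Ici a, 1 ≤ (Real.tanh (2 * y))⁻¹ := fun y hy =>
    (one_le_inv₀ (by linarith [tlow y hy])).2 (tlt y).le
  have sup : ∀ y ∈ Ici a, (Real.tanh (2 * y))⁻¹ ≤ 20 / 9 := fun y hy => by
    rw [inv_le_comm₀ (by linarith [tlow y hy]) (by norm_num)]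
    linarith [tlow y hy]
  have right := mul_integral_sq_le_of_riccati_Ioi (r := r) (r' := r') (κ := 1 / 20) (C := 60)
    (η := fun y => 2 * ((Real.tanh (2 * y))⁻¹ - 3 / 2 * Real.tanh (2 * y)
      + 1 / 20 * ((Real.tanh (2 * y))⁻¹) ^ 2))
    (η' := fun y => 4 * (1 - Real.tanh (2 * y) ^ 2) * (-((Real.tanh (2 * y))⁻¹) ^ 2 - 3 / 2
      - 1 / 10 * ((Real.tanh (2 * y))⁻¹) ^ 3))
    (W := fun y => 15 * Real.tanh (2 * y) ^ 2 - 14) (a := a) hr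
    (hr2.mono_measure (Measure.restrict_mono hsub le_rfl))
    (hr2'.mono_measure (Measure.restrict_mono hsub le_rfl))
    (fun y hy => by
      have hne : Real.tanh (2 * y) ≠ 0 := by linarith [tlow y hy]
      have hT := hasDerivAt_tanh_mul 2 y
      have hs : HasDerivAt (fun y => (Real.tanh (2 * y))⁻¹) _ y := hT.inv hne
      have := ((hs.sub (hT.const_mul (3 / 2))).add
        ((hs.pow 2).const_mul (1 / 20))).const_mul 2
      refine this.congr_deriv ?_
      rw [show 2 - 1 = 1 from rfl, pow_one]
      push_cast
      field_simp
      ring)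
    (by
      have hi : ContinuousOn (fun y => (Real.tanh (2 * y))⁻¹) (Ici a) :=
        cT.continuousOn.inv₀ fun y hy => by linarith [tlow y hy]
      have hT : ContinuousOn (fun y => Real.tanh (2 * y)) (Ici a) := cT.continuousOn
      fun_prop)
    (by fun_prop)
    (fun y hy => by
      have t0 := tlow y hy
      have t1 := tlt y
      have s0 := slow y hy
      have s1 := sup y hy
      rw [abs_le]
      constructor <;> nlinarith)
    (fun y hy => by
      have t0 := tlow y hy
      have t1 := tlt y
      have s0 := slow y hy
      have s1 := sup y hy
      set s := (Real.tanh (2 * y))⁻¹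
      have q0 : 0 ≤ 1 - Real.tanh (2 * y) ^ 2 := by nlinarith
      have q1 : 1 - Real.tanh (2 * y) ^ 2 ≤ 1 := by nlinarith
      have s2 : s ^ 2 ≤ 5 := by nlinarith
      have s3 : s ^ 3 ≤ 12 := by nlinarith
      have s3' : 0 ≤ s ^ 3 := by positivity
      rw [abs_le]
      constructor <;> nlinarith)
    (fun y hy => by
      have := tlow y hy
      have := tlt y
      rw [abs_le]
      constructor <;> nlinarith)
    (fun y hy => by
      have t0 := tlow y hy
      have t1 := tlt y
      have s0 := slow y hy
      have s1 := sup y hy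
      have hne : Real.tanh (2 * y) ≠ 0 := by linarith
      have e : 4 * (1 - Real.tanh (2 * y) ^ 2) * (-((Real.tanh (2 * y))⁻¹) ^ 2 - 3 / 2
          - 1 / 10 * ((Real.tanh (2 * y))⁻¹) ^ 3) + (2 * ((Real.tanh (2 * y))⁻¹
          - 3 / 2 * Real.tanh (2 * y) + 1 / 20 * ((Real.tanh (2 * y))⁻¹) ^ 2)) ^ 2
          = 15 * Real.tanh (2 * y) ^ 2 - 14
            + 1 / 5 * (Real.tanh (2 * y))⁻¹ * (1 / 20 * (Real.tanh (2 * y))⁻¹ ^ 3 - 1) := by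
        field_simp
        ring
      rw [e]
      set s := (Real.tanh (2 * y))⁻¹
      have s2 : s ^ 2 ≤ 400 / 81 := by nlinarith
      have s3 : s ^ 3 ≤ 11 := by nlinarith
      nlinarith)
    h1
  have hQ : IntegrableOn (fun y => r' y ^ 2 + (15 * Real.tanh (2 * y) ^ 2 - 14) * r y ^ 2)
      (Ioi 0) := integrable_form hr2 hr2'
  have hN : IntegrableOn (fun y => r y ^ 2) (Ioi 0) := hr2.integrable_sq
  have hu : Ioc 0 a ∪ Ioi a = Ioi (0 : ℝ) := Ioc_union_Ioi_eq_Ioi ha.le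
  have split : ∀ {g : ℝ → ℝ}, IntegrableOn g (Ioi 0) →
      ∫ y in Ioi 0, g y = (∫ y in Ioc 0 a, g y) + ∫ y in Ioi a, g y := by
    intro g hg
    rw [← hu]
    exact setIntegral_union (Ioc_disjoint_Ioi le_rfl) measurableSet_Ioi
      (hg.mono_set Ioc_subset_Ioi_self) (hg.mono_set hsub)
  rw [split hN, split hQ, mul_add]
  exact add_le_add left right

/-! ### The ground state profile -/

/-- The profile `cosh((p-1)y/2)^{-2/(p-1)}`, equal to `Q_p` up to a constant factor. -/
noncomputable def sechProfile (p y : ℝ) : ℝ :=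
  Real.cosh ((p - 1) / 2 * y) ^ (-(2 / (p - 1)))

theorem sechProfile_pos (p y : ℝ) : 0 < sechProfile p y :=
  Real.rpow_pos_of_pos (Real.cosh_pos _) _

theorem sechProfile_zero (p : ℝ) : sechProfile p 0 = 1 := by simp [sechProfile]

theorem hasDerivAt_sechProfile {p : ℝ} (hp : 1 < p) (y : ℝ) :
    HasDerivAt (sechProfile p) (-Real.tanh ((p - 1) / 2 * y) * sechProfile p y) y := by
  have hl : HasDerivAt (fun y => (p - 1) / 2 * y) ((p - 1) / 2) y := by
    simpa using (hasDerivAt_id y).const_mul ((p - 1) / 2)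
  have hc := Real.cosh_pos ((p - 1) / 2 * y)
  have h := (hl.cosh).rpow_const (p := -(2 / (p - 1))) (Or.inl hc.ne')
  refine h.congr_deriv ?_
  have : p - 1 ≠ 0 := by linarith
  rw [Real.rpow_sub_one hc.ne', Real.tanh_eq_sinh_div_cosh, sechProfile]
  field_simp

theorem continuous_sechProfile {p : ℝ} (hp : 1 < p) : Continuous (sechProfile p) :=
  continuous_iff_continuousAt.2 fun y => (hasDerivAt_sechProfile hp y).continuousAt

theorem sechProfile_le_exp {p : ℝ} (hp : 3 ≤ p) (y : ℝ) :
    sechProfile p y ≤ 2 * Real.exp (-|y|) := by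
  have hk : 0 < p - 1 := by linarith
  have h1 : Real.exp ((p - 1) / 2 * |y|) / 2 ≤ Real.cosh ((p - 1) / 2 * y) := by
    rw [← Real.cosh_abs, abs_mul, abs_of_pos (by positivity : 0 < (p - 1) / 2), Real.cosh_eq]
    have := Real.exp_pos (-((p - 1) / 2 * |y|))
    linarith
  have h2 := Real.rpow_le_rpow_of_nonpos (by positivity) h1
    (by rw [neg_nonpos]; positivity : -(2 / (p - 1)) ≤ 0)
  refine h2.trans ?_
  rw [Real.div_rpow (Real.exp_pos _).le (by norm_num), ← Real.exp_mul,
    Real.rpow_neg (by norm_num : (0 : ℝ) ≤ 2), div_inv_eq_mul, mul_comm]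
  have e : (p - 1) / 2 * |y| * -(2 / (p - 1)) = -|y| := by field_simp
  rw [e]
  refine mul_le_mul_of_nonneg_right ?_ (Real.exp_pos _).le
  calc (2 : ℝ) ^ (2 / (p - 1)) ≤ 2 ^ (1 : ℝ) := by
        refine Real.rpow_le_rpow_of_exponent_le (by norm_num) ?_
        rw [div_le_one hk]
        linarith
    _ = 2 := Real.rpow_one 2

theorem one_add_sq_pow_mul_sechProfile_le {p : ℝ} (hp : 3 ≤ p) (y : ℝ) :
    (1 + y ^ 2) ^ 4 * sechProfile p y ≤ 2 * 32 ^ 4 := by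
  have h1 : 1 + y ^ 2 ≤ 32 * Real.exp (|y| / 4) := by
    have := Real.quadratic_le_exp_of_nonneg (x := |y| / 4) (by positivity)
    nlinarith [abs_nonneg y, sq_abs y]
  have h2 : (1 + y ^ 2) ^ 4 ≤ (32 * Real.exp (|y| / 4)) ^ 4 :=
    pow_le_pow_left₀ (by positivity) h1 4
  have h3 : (32 * Real.exp (|y| / 4)) ^ 4 = 32 ^ 4 * Real.exp |y| := by
    rw [mul_pow, ← Real.exp_nat_mul]
    congr 2
    push_cast
    ring
  rw [h3] at h2
  calc (1 + y ^ 2) ^ 4 * sechProfile p y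
      ≤ (32 ^ 4 * Real.exp |y|) * (2 * Real.exp (-|y|)) :=
        mul_le_mul h2 (sechProfile_le_exp hp y) (sechProfile_pos p y).le (by positivity)
    _ = 2 * 32 ^ 4 * (Real.exp |y| * Real.exp (-|y|)) := by ring
    _ = 2 * 32 ^ 4 := by rw [← Real.exp_add, add_neg_cancel, Real.exp_zero, mul_one]

theorem sq_le_of_abs_le_sechProfile {p C x y : ℝ} (hp : 3 ≤ p)
    (h : |x| ≤ C * ((1 + y ^ 2) * sechProfile p y)) :
    x ^ 2 ≤ C ^ 2 * (2 * 32 ^ 4) ^ 2 * (1 + y ^ 2)⁻¹ := by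
  have h1 := one_add_sq_pow_mul_sechProfile_le hp y
  have hP := sechProfile_pos p y
  set P := sechProfile p y
  set w := 1 + y ^ 2
  have hw : 1 ≤ w := by simp only [w]; nlinarith [sq_nonneg y]
  have hw0 : 0 < w := by linarith
  have h2 : x ^ 2 ≤ (C * (w * P)) ^ 2 := by
    rw [← sq_abs]
    exact pow_le_pow_left₀ (abs_nonneg _) h 2
  have h3 : (w * P) ^ 2 * w ≤ (2 * 32 ^ 4) ^ 2 := by
    calc (w * P) ^ 2 * w = w ^ 3 * P ^ 2 := by ring
      _ ≤ w ^ 8 * P ^ 2 :=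
        mul_le_mul_of_nonneg_right (pow_le_pow_right₀ hw (by norm_num)) (sq_nonneg _)
      _ = (w ^ 4 * P) ^ 2 := by ring
      _ ≤ _ := pow_le_pow_left₀ (by positivity) h1 2
  rw [← div_eq_mul_inv, le_div_iff₀ hw0]
  calc x ^ 2 * w ≤ (C * (w * P)) ^ 2 * w := mul_le_mul_of_nonneg_right h2 hw0.le
    _ = C ^ 2 * ((w * P) ^ 2 * w) := by ring
    _ ≤ C ^ 2 * (2 * 32 ^ 4) ^ 2 := mul_le_mul_of_nonneg_left h3 (sq_nonneg _)

theorem memLp_two_of_abs_le_sechProfile {p C : ℝ} (hp : 3 ≤ p) {g : ℝ → ℝ} (hg : Continuous g)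
    (h : ∀ y, |g y| ≤ C * ((1 + y ^ 2) * sechProfile p y)) : MemLp g 2 := by
  rw [memLp_two_iff_integrable_sq hg.aestronglyMeasurable]
  refine (integrable_inv_one_add_sq.const_mul (C ^ 2 * (2 * 32 ^ 4) ^ 2)).mono'
    (hg.pow 2).aestronglyMeasurable (Eventually.of_forall fun y => ?_)
  rw [Real.norm_eq_abs, abs_of_nonneg (sq_nonneg _)]
  exact sq_le_of_abs_le_sechProfile hp (h y)

/-! ### The half-line estimates at the critical exponent -/

/-- `ΛQ₅` up to a constant factor. -/
noncomputable def critLam (y : ℝ) : ℝ := (1 / 2 - y * Real.tanh (2 * y)) * sechProfile 5 y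

/-- The derivative of `critLam`. -/
noncomputable def critLamDeriv (y : ℝ) : ℝ :=
  (3 * y * Real.tanh (2 * y) ^ 2 - 2 * y - 3 / 2 * Real.tanh (2 * y)) * sechProfile 5 y

/-- `-Q₅'` up to a constant factor, the kernel of the linearized operator. -/
noncomputable def critKer (y : ℝ) : ℝ := Real.tanh (2 * y) * sechProfile 5 y

/-- The derivative of `critKer`. -/
noncomputable def critKerDeriv (y : ℝ) : ℝ := (2 - 3 * Real.tanh (2 * y) ^ 2) * sechProfile 5 y

theorem hasDerivAt_sechProfile_five (y : ℝ) :
    HasDerivAt (sechProfile 5) (-(Real.tanh (2 * y) * sechProfile 5 y)) y := by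
  have := hasDerivAt_sechProfile (p := 5) (by norm_num) y
  refine this.congr_deriv ?_
  norm_num

theorem hasDerivAt_critLam (y : ℝ) : HasDerivAt critLam (critLamDeriv y) y := by
  have hT := hasDerivAt_tanh_mul 2 y
  have h := (((hasDerivAt_id' y).mul hT).const_sub (1 / 2)).mul (hasDerivAt_sechProfile_five y)
  refine h.congr_deriv ?_
  simp only [critLamDeriv, Pi.mul_apply]
  ring

theorem hasDerivAt_critLamDeriv (y : ℝ) :
    HasDerivAt critLamDeriv
      ((15 * Real.tanh (2 * y) ^ 2 - 14) * critLam y + 2 * sechProfile 5 y) y := by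
  have hT := hasDerivAt_tanh_mul 2 y
  have h := (((((hasDerivAt_id' y).const_mul 3).mul (hT.pow 2)).sub
    ((hasDerivAt_id' y).const_mul 2)).sub (hT.const_mul (3 / 2))).mul
    (hasDerivAt_sechProfile_five y)
  refine h.congr_deriv ?_
  simp only [critLam, Pi.mul_apply, Pi.pow_apply, Pi.sub_apply]
  push_cast
  ring

theorem hasDerivAt_critKer (y : ℝ) : HasDerivAt critKer (critKerDeriv y) y := by
  refine ((hasDerivAt_tanh_mul 2 y).mul (hasDerivAt_sechProfile_five y)).congr_deriv ?_
  simp only [critKerDeriv]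
  ring

theorem hasDerivAt_critKerDeriv (y : ℝ) :
    HasDerivAt critKerDeriv ((15 * Real.tanh (2 * y) ^ 2 - 14) * critKer y) y := by
  have h := ((((hasDerivAt_tanh_mul 2 y).pow 2).const_mul 3).const_sub 2).mul
    (hasDerivAt_sechProfile_five y)
  refine h.congr_deriv ?_
  simp only [critKer, Pi.pow_apply]
  push_cast
  ring

theorem continuous_critLam : Continuous critLam :=
  continuous_iff_continuousAt.2 fun y => (hasDerivAt_critLam y).continuousAt

theorem continuous_critLamDeriv : Continuous critLamDeriv :=
  continuous_iff_continuousAt.2 fun y => (hasDerivAt_critLamDeriv y).continuousAt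

theorem continuous_critKerDeriv : Continuous critKerDeriv :=
  continuous_iff_continuousAt.2 fun y => (hasDerivAt_critKerDeriv y).continuousAt

theorem continuous_sechProfile_five : Continuous (sechProfile 5) :=
  continuous_sechProfile (by norm_num)

theorem memLp_two_mul_sechProfile_five {c : ℝ → ℝ} (hc : Continuous c) {C : ℝ}
    (h : ∀ y, |c y| ≤ C * (1 + y ^ 2)) : MemLp (fun y => c y * sechProfile 5 y) 2 := by
  refine memLp_two_of_abs_le_sechProfile (p := 5) (C := C) (by norm_num)
    (hc.mul continuous_sechProfile_five) fun y => ?_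
  rw [abs_mul, abs_of_pos (sechProfile_pos 5 y), ← mul_assoc]
  exact mul_le_mul_of_nonneg_right (h y) (sechProfile_pos 5 y).le

theorem memLp_sechProfile_five : MemLp (sechProfile 5) 2 := by
  have := memLp_two_mul_sechProfile_five (c := fun _ => 1) (C := 1) continuous_const
    (fun y => by rw [abs_one]; nlinarith [sq_nonneg y])
  simpa using this

theorem memLp_mul_sechProfile_five : MemLp (fun y => y * sechProfile 5 y) 2 :=
  memLp_two_mul_sechProfile_five (c := fun y => y) (C := 1) continuous_id fun y => by
    rw [abs_le]
    constructor <;> nlinarith [sq_nonneg (y - 1), sq_nonneg (y + 1)]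

theorem abs_mul_tanh_le (y x : ℝ) : |y * Real.tanh x| ≤ |y| := by
  rw [abs_mul]
  exact mul_le_of_le_one_right (abs_nonneg _) (Real.abs_tanh_lt_one x).le

theorem memLp_critLam : MemLp critLam 2 := by
  have cT := continuous_tanh_mul 2
  refine memLp_two_mul_sechProfile_five (c := fun y => 1 / 2 - y * Real.tanh (2 * y)) (C := 2)
    (by fun_prop) fun y => ?_
  have := abs_mul_tanh_le y (2 * y)
  have h2 := abs_sub (1 / 2) (y * Real.tanh (2 * y))
  rw [abs_of_pos (by norm_num : (0 : ℝ) < 1 / 2)] at h2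
  nlinarith [sq_nonneg (|y| - 1), sq_abs y]

theorem memLp_mul_critLam : MemLp (fun y => y * critLam y) 2 := by
  have cT := continuous_tanh_mul 2
  have h := memLp_two_mul_sechProfile_five (c := fun y => y * (1 / 2 - y * Real.tanh (2 * y)))
    (C := 2) (by fun_prop) fun y => by
      have := abs_mul_tanh_le y (2 * y)
      have h2 := abs_sub (1 / 2) (y * Real.tanh (2 * y))
      rw [abs_of_pos (by norm_num : (0 : ℝ) < 1 / 2)] at h2
      rw [abs_mul]
      nlinarith [sq_nonneg (|y| - 1), sq_abs y, abs_nonneg y]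
  refine (memLp_congr_ae (Eventually.of_forall fun y => ?_)).1 h
  simp only [critLam]
  ring

theorem memLp_critKer : MemLp critKer 2 :=
  memLp_two_mul_sechProfile_five (C := 1) (continuous_tanh_mul 2) fun y => by
    have := Real.abs_tanh_lt_one (2 * y)
    nlinarith [sq_nonneg y]

theorem memLp_critKerDeriv : MemLp critKerDeriv 2 := by
  have cT := continuous_tanh_mul 2
  refine memLp_two_mul_sechProfile_five (c := fun y => 2 - 3 * Real.tanh (2 * y) ^ 2) (C := 5)
    (by fun_prop) fun y => ?_
  have := Real.tanh_sq_lt_one (2 * y)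
  rw [abs_le]
  constructor <;> nlinarith [sq_nonneg y, sq_nonneg (Real.tanh (2 * y))]

theorem memLp_critLamDeriv : MemLp critLamDeriv 2 := by
  have cT := continuous_tanh_mul 2
  refine memLp_two_mul_sechProfile_five
    (c := fun y => 3 * y * Real.tanh (2 * y) ^ 2 - 2 * y - 3 / 2 * Real.tanh (2 * y)) (C := 5)
    (by fun_prop) fun y => ?_
  have h1 := abs_le.1 (Real.abs_tanh_lt_one (2 * y)).le
  have h2 := Real.tanh_sq_lt_one (2 * y)
  have h3 : |y * (3 * Real.tanh (2 * y) ^ 2 - 2)| ≤ |y| * 2 := by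
    rw [abs_mul]
    refine mul_le_mul_of_nonneg_left ?_ (abs_nonneg _)
    rw [abs_le]
    constructor <;> nlinarith [sq_nonneg (Real.tanh (2 * y))]
  have h4 := abs_le.1 h3
  rw [abs_le]
  constructor <;> nlinarith [sq_nonneg (|y| - 1), sq_abs y]

theorem integral_critLam_mul_sechProfile : ∫ y in Ioi 0, critLam y * sechProfile 5 y = 0 := by
  rw [integral_Ioi_deriv_eq_neg (H := fun y => 1 / 2 * ((y * sechProfile 5 y) * sechProfile 5 y))]
  · simp
  · intro y _
    have hS := hasDerivAt_sechProfile_five y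
    refine ((((hasDerivAt_id' y).mul hS).mul hS).const_mul (1 / 2)).congr_deriv ?_
    simp only [critLam, Pi.mul_apply]
    ring
  · exact (memLp_critLam.integrable_mul memLp_sechProfile_five).integrableOn
  · exact ((memLp_mul_sechProfile_five.integrable_mul
      memLp_sechProfile_five).const_mul _).integrableOn

theorem integral_critKer_mul_sechProfile : ∫ y in Ioi 0, critKer y * sechProfile 5 y = 1 / 2 := by
  rw [integral_Ioi_deriv_eq_neg (H := fun y => -1 / 2 * (sechProfile 5 y * sechProfile 5 y))]
  · rw [sechProfile_zero]
    norm_num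
  · intro y _
    have hS := hasDerivAt_sechProfile_five y
    refine ((hS.mul hS).const_mul (-1 / 2)).congr_deriv ?_
    simp only [critKer]
    ring
  · exact (memLp_critKer.integrable_mul memLp_sechProfile_five).integrableOn
  · exact ((memLp_sechProfile_five.integrable_mul
      memLp_sechProfile_five).const_mul _).integrableOn

theorem integral_critKer_mul_mul_critLam :
    ∫ y in Ioi 0, critKer y * (y * critLam y) = -∫ y in Ioi 0, critLam y ^ 2 := by
  have e : ∀ y, critKer y * (y * critLam y)
      = 1 / 2 * (critLam y * sechProfile 5 y) - critLam y ^ 2 := fun y => by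
    simp only [critKer, critLam]
    ring
  simp_rw [e]
  have h1 : IntegrableOn (fun y => 1 / 2 * (critLam y * sechProfile 5 y)) (Ioi 0) :=
    ((memLp_critLam.integrable_mul memLp_sechProfile_five).const_mul _).integrableOn
  rw [integral_sub h1 memLp_critLam.integrable_sq.integrableOn, integral_const_mul,
    integral_critLam_mul_sechProfile]
  ring

theorem integral_critLam_sq_pos : 0 < ∫ y in Ioi 0, critLam y ^ 2 := by
  have hi : IntegrableOn (fun y => critLam y ^ 2) (Ioi 0) :=
    memLp_critLam.integrable_sq.integrableOn
  rw [setIntegral_pos_iff_support_of_nonneg_ae (Eventually.of_forall fun y => sq_nonneg _) hi]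
  have hc : Continuous fun y => critLam y ^ 2 := continuous_critLam.pow 2
  have h0 : (0 : ℝ) ∈ Function.support fun y => critLam y ^ 2 := by
    simp [critLam, sechProfile_zero]
  obtain ⟨ε, hε, hb⟩ := Metric.isOpen_iff.1 hc.isOpen_support 0 h0
  have hs : Ioo 0 ε ⊆ (Function.support fun y => critLam y ^ 2) ∩ Ioi 0 := fun y hy =>
    ⟨hb (by rw [Metric.mem_ball, Real.dist_eq, sub_zero, abs_of_pos hy.1]; exact hy.2), hy.1⟩
  refine lt_of_lt_of_le ?_ (measure_mono hs)
  rw [Real.volume_Ioo, sub_zero]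
  exact ENNReal.ofReal_pos.2 hε

/-- The half-line form of `F + s Λ - m u`, where `u` is in the kernel, when this function vanishes
at the origin. -/
theorem integral_form_shift {F F' : ℝ → ℝ} (s m : ℝ) (hF : ∀ y, HasDerivAt F (F' y) y)
    (hF2 : MemLp F 2 (volume.restrict (Ioi 0))) (hF2' : MemLp F' 2 (volume.restrict (Ioi 0)))
    (h0 : F 0 + s * critLam 0 - m * critKer 0 = 0) :
    ∫ y in Ioi 0, ((F' y + s * critLamDeriv y - m * critKerDeriv y) ^ 2
        + (15 * Real.tanh (2 * y) ^ 2 - 14) * (F y + s * critLam y - m * critKer y) ^ 2)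
      = (∫ y in Ioi 0, (F' y ^ 2 + (15 * Real.tanh (2 * y) ^ 2 - 14) * F y ^ 2))
        - 4 * s * ∫ y in Ioi 0, F y * sechProfile 5 y := by
  have mS := memLp_sechProfile_five.restrict (Ioi 0)
  have mX := memLp_mul_sechProfile_five.restrict (Ioi 0)
  have mL := memLp_critLam.restrict (Ioi 0)
  have mL' := memLp_critLamDeriv.restrict (Ioi 0)
  have mK := memLp_critKer.restrict (Ioi 0)
  have mK' := memLp_critKerDeriv.restrict (Ioi 0)
  have mr : MemLp (fun y => F y + s * critLam y - m * critKer y) 2 (volume.restrict (Ioi 0)) :=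
    (hF2.add (mL.const_mul s)).sub (mK.const_mul m)
  have mr' : MemLp (fun y => F' y + s * critLamDeriv y - m * critKerDeriv y) 2
      (volume.restrict (Ioi 0)) := (hF2'.add (mL'.const_mul s)).sub (mK'.const_mul m)
  have i1 := integrable_form mr mr'
  have i2 := integrable_form hF2 hF2'
  have i3 : IntegrableOn (fun y => 4 * s * (F y * sechProfile 5 y)) (Ioi 0) :=
    (hF2.integrable_mul mS).const_mul _
  have i12 : IntegrableOn (fun y => ((F' y + s * critLamDeriv y - m * critKerDeriv y) ^ 2
        + (15 * Real.tanh (2 * y) ^ 2 - 14) * (F y + s * critLam y - m * critKer y) ^ 2)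
      - (F' y ^ 2 + (15 * Real.tanh (2 * y) ^ 2 - 14) * F y ^ 2)) (Ioi 0) := i1.sub i2
  have i123 : IntegrableOn (fun y => ((F' y + s * critLamDeriv y - m * critKerDeriv y) ^ 2
        + (15 * Real.tanh (2 * y) ^ 2 - 14) * (F y + s * critLam y - m * critKer y) ^ 2)
      - (F' y ^ 2 + (15 * Real.tanh (2 * y) ^ 2 - 14) * F y ^ 2)
      + 4 * s * (F y * sechProfile 5 y)) (Ioi 0) := i12.add i3
  have iH : IntegrableOn (fun y => 2 * s * (F y * critLamDeriv y) - 2 * m * (F y * critKerDeriv y)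
      + s ^ 2 * (critLam y * critLamDeriv y) + m ^ 2 * (critKer y * critKerDeriv y)
      - 2 * s * m * (critLam y * critKerDeriv y)
      - s ^ 2 * ((y * sechProfile 5 y) * sechProfile 5 y)) (Ioi 0) :=
    (((((((hF2.integrable_mul mL').const_mul (2 * s)).sub
      ((hF2.integrable_mul mK').const_mul (2 * m))).add
      ((mL.integrable_mul mL').const_mul (s ^ 2))).add
      ((mK.integrable_mul mK').const_mul (m ^ 2))).sub
      ((mL.integrable_mul mK').const_mul (2 * s * m))).sub
      ((mX.integrable_mul mS).const_mul (s ^ 2)))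
  have key := integral_Ioi_deriv_eq_neg (a := 0)
    (H := fun y => 2 * s * (F y * critLamDeriv y) - 2 * m * (F y * critKerDeriv y)
      + s ^ 2 * (critLam y * critLamDeriv y) + m ^ 2 * (critKer y * critKerDeriv y)
      - 2 * s * m * (critLam y * critKerDeriv y)
      - s ^ 2 * ((y * sechProfile 5 y) * sechProfile 5 y))
    (H' := fun y => ((F' y + s * critLamDeriv y - m * critKerDeriv y) ^ 2
        + (15 * Real.tanh (2 * y) ^ 2 - 14) * (F y + s * critLam y - m * critKer y) ^ 2)
      - (F' y ^ 2 + (15 * Real.tanh (2 * y) ^ 2 - 14) * F y ^ 2)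
      + 4 * s * (F y * sechProfile 5 y))
    (fun y _ => by
      have dS := hasDerivAt_sechProfile_five y
      have dL := hasDerivAt_critLam y
      have dL' := hasDerivAt_critLamDeriv y
      have dK := hasDerivAt_critKer y
      have dK' := hasDerivAt_critKerDeriv y
      refine (((((((hF y).mul dL').const_mul (2 * s)).sub
        (((hF y).mul dK').const_mul (2 * m))).add ((dL.mul dL').const_mul (s ^ 2))).add
        ((dK.mul dK').const_mul (m ^ 2))).sub ((dL.mul dK').const_mul (2 * s * m))).sub
        ((((hasDerivAt_id' y).mul dS).mul dS).const_mul (s ^ 2)) |>.congr_deriv ?_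
      simp only [critLam, critKer, critLamDeriv, critKerDeriv, Pi.mul_apply]
      ring)
    i123 iH
  rw [integral_add i12 i3, integral_sub i1 i2, integral_const_mul] at key
  have hz : 2 * s * (F 0 * critLamDeriv 0) - 2 * m * (F 0 * critKerDeriv 0)
      + s ^ 2 * (critLam 0 * critLamDeriv 0) + m ^ 2 * (critKer 0 * critKerDeriv 0)
      - 2 * s * m * (critLam 0 * critKerDeriv 0)
      - s ^ 2 * ((0 * sechProfile 5 0) * sechProfile 5 0) = 0 := by
    simp only [critLam, critKer, critLamDeriv, critKerDeriv, sechProfile_zero, mul_zero,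
      Real.tanh_zero] at h0 ⊢
    linear_combination -4 * m * h0
  rw [hz] at key
  linarith

/-- The shifted function of `integral_form_shift` satisfies the Dirichlet estimate once `s` and `m`
make it vanish at the origin and at the point where `tanh (2 y) = 9 / 20`. -/
theorem exists_shift_coercive {F F' : ℝ → ℝ} (s : ℝ) (hF : ∀ y, HasDerivAt F (F' y) y)
    (cF' : Continuous F')
    (hF2 : MemLp F 2 (volume.restrict (Ioi 0))) (hF2' : MemLp F' 2 (volume.restrict (Ioi 0)))
    (h0 : F 0 + s * critLam 0 = 0) :
    ∃ m : ℝ, 1 / 20 * ∫ y in Ioi 0, (F y + s * critLam y - m * critKer y) ^ 2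
      ≤ (∫ y in Ioi 0, (F' y ^ 2 + (15 * Real.tanh (2 * y) ^ 2 - 14) * F y ^ 2))
        - 4 * s * ∫ y in Ioi 0, F y * sechProfile 5 y := by
  obtain ⟨a, ha, hta⟩ := exists_tanh_two_mul_eq
  have hKa : critKer a ≠ 0 := by
    rw [critKer, hta]
    exact mul_ne_zero (by norm_num) (sechProfile_pos 5 a).ne'
  have hK0 : critKer 0 = 0 := by simp [critKer]
  refine ⟨(F a + s * critLam a) / critKer a, ?_⟩
  set m := (F a + s * critLam a) / critKer a with hm
  have hz : F 0 + s * critLam 0 - m * critKer 0 = 0 := by rw [h0, hK0]; ring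
  rw [← integral_form_shift s m hF hF2 hF2' hz]
  refine dirichlet_coercive (r := fun y => F y + s * critLam y - m * critKer y) ha hta
    (fun y => ((hF y).add ((hasDerivAt_critLam y).const_mul s)).sub
      ((hasDerivAt_critKer y).const_mul m)) ?_ ?_ ?_ hz ?_
  · exact (cF'.add (continuous_critLamDeriv.const_mul s)).sub (continuous_critKerDeriv.const_mul m)
  · exact (hF2.add ((memLp_critLam.restrict _).const_mul s)).sub
      ((memLp_critKer.restrict _).const_mul m)
  · exact (hF2'.add ((memLp_critLamDeriv.restrict _).const_mul s)).sub
      ((memLp_critKerDeriv.restrict _).const_mul m)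
  · simp only [hm]
    field_simp
    ring

theorem integral_sq_le_shift {F : ℝ → ℝ} (s m : ℝ) (hF2 : MemLp F 2 (volume.restrict (Ioi 0))) :
    ∫ y in Ioi 0, F y ^ 2 ≤ 3 * ((∫ y in Ioi 0, (F y + s * critLam y - m * critKer y) ^ 2)
      + s ^ 2 * (∫ y in Ioi 0, critLam y ^ 2) + m ^ 2 * ∫ y in Ioi 0, critKer y ^ 2) := by
  have mL := memLp_critLam.restrict (Ioi 0)
  have mK := memLp_critKer.restrict (Ioi 0)
  have mr : MemLp (fun y => F y + s * critLam y - m * critKer y) 2 (volume.restrict (Ioi 0)) :=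
    (hF2.add (mL.const_mul s)).sub (mK.const_mul m)
  have i1 : IntegrableOn (fun y => (F y + s * critLam y - m * critKer y) ^ 2
      + s ^ 2 * critLam y ^ 2) (Ioi 0) := mr.integrable_sq.add (mL.integrable_sq.const_mul _)
  have i2 : IntegrableOn (fun y => m ^ 2 * critKer y ^ 2) (Ioi 0) := mK.integrable_sq.const_mul _
  have i3 : IntegrableOn (fun y => (F y + s * critLam y - m * critKer y) ^ 2
      + s ^ 2 * critLam y ^ 2 + m ^ 2 * critKer y ^ 2) (Ioi 0) := i1.add i2
  rw [← integral_const_mul (s ^ 2), ← integral_const_mul (m ^ 2),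
    ← integral_add mr.integrable_sq (mL.integrable_sq.const_mul _), ← integral_add i1 i2,
    ← integral_const_mul]
  refine integral_mono hF2.integrable_sq (i3.const_mul 3) fun y => ?_
  simp only
  set r := F y + s * critLam y - m * critKer y with hr
  have e : F y = r - s * critLam y + m * critKer y := by rw [hr]; ring
  rw [e]
  nlinarith [sq_nonneg (r + s * critLam y), sq_nonneg (r - m * critKer y),
    sq_nonneg (s * critLam y + m * critKer y)]

theorem integral_shift_mul {F g : ℝ → ℝ} (s m : ℝ) (hF2 : MemLp F 2 (volume.restrict (Ioi 0)))
    (hg : MemLp g 2 (volume.restrict (Ioi 0))) :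
    ∫ y in Ioi 0, (F y + s * critLam y - m * critKer y) * g y
      = (∫ y in Ioi 0, F y * g y) + s * (∫ y in Ioi 0, critLam y * g y)
        - m * ∫ y in Ioi 0, critKer y * g y := by
  have i1 : IntegrableOn (fun y => F y * g y) (Ioi 0) := hF2.integrable_mul hg
  have i2 : IntegrableOn (fun y => s * (critLam y * g y)) (Ioi 0) :=
    ((memLp_critLam.restrict _).integrable_mul hg).const_mul _
  have i3 : IntegrableOn (fun y => m * (critKer y * g y)) (Ioi 0) :=
    ((memLp_critKer.restrict _).integrable_mul hg).const_mul _
  have i12 : IntegrableOn (fun y => F y * g y + s * (critLam y * g y)) (Ioi 0) := i1.add i2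
  have e : ∀ y, (F y + s * critLam y - m * critKer y) * g y
      = F y * g y + s * (critLam y * g y) - m * (critKer y * g y) := fun y => by ring
  simp_rw [e]
  rw [integral_sub i12 i3, integral_add i1 i2, integral_const_mul, integral_const_mul]

theorem sq_integral_shift_mul_le {F g : ℝ → ℝ} (s m : ℝ)
    (hF2 : MemLp F 2 (volume.restrict (Ioi 0))) (hg : MemLp g 2 (volume.restrict (Ioi 0))) :
    (∫ y in Ioi 0, (F y + s * critLam y - m * critKer y) * g y) ^ 2
      ≤ (∫ y in Ioi 0, (F y + s * critLam y - m * critKer y) ^ 2) * ∫ y in Ioi 0, g y ^ 2 :=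
  sq_integral_mul_le ((hF2.add ((memLp_critLam.restrict _).const_mul s)).sub
    ((memLp_critKer.restrict _).const_mul m)) hg

set_option maxHeartbeats 1000000 in
theorem exists_coercive_const_of_shift {lam sig tau nu : ℝ} (hlam : 0 < lam) (hsig : 0 ≤ sig)
    (hnu : 0 ≤ nu) :
    ∃ κ C : ℝ, 0 < κ ∧ 0 < C ∧ ∀ R s m A B N E : ℝ, 0 ≤ R →
      (A - m / 2) ^ 2 ≤ R * sig → (B + s * lam - m * tau) ^ 2 ≤ R * lam →
      N ≤ 3 * (R + s ^ 2 * lam + m ^ 2 * nu) → 1 / 20 * R ≤ E - 4 * s * A →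
      κ * N - C * (A ^ 2 + B ^ 2) ≤ E := by
  set c₁ := 8 + 8 * sig with hc₁
  set c₂ := (3 * lam + 3 + 3 * tau ^ 2 * c₁) / lam ^ 2 with hc₂
  have p1 : 0 < c₁ := by positivity
  have p2 : 0 < c₂ := by positivity
  set M := c₂ + 3 * (1 + lam * c₂ + nu * c₁) with hM
  have pM : 0 < M := by positivity
  refine ⟨1 / (40 * M), 1 + 160 * M, by positivity, by positivity, ?_⟩
  intro R s m A B N E hR h1 h2 h3 h4
  set X := R + (A ^ 2 + B ^ 2) with hX
  have pX : 0 ≤ X := by positivity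
  have em : m ^ 2 ≤ c₁ * X := by
    have : m ^ 2 ≤ 8 * A ^ 2 + 8 * (R * sig) := by
      nlinarith [sq_nonneg (2 * A - (A - m / 2)), sq_nonneg (A + (A - m / 2))]
    refine this.trans ?_
    rw [hc₁, hX]
    have : 0 ≤ sig * (A ^ 2 + B ^ 2) := by positivity
    nlinarith [sq_nonneg B]
  have es : s ^ 2 ≤ c₂ * X := by
    rw [hc₂, div_mul_eq_mul_div, le_div_iff₀ (by positivity)]
    have e1 : s ^ 2 * lam ^ 2 ≤ 3 * (R * lam) + 3 * B ^ 2 + 3 * tau ^ 2 * m ^ 2 := by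
      set I := B + s * lam - m * tau with hI
      have : s * lam = I - B + m * tau := by rw [hI]; ring
      have e2 : s ^ 2 * lam ^ 2 = (I - B + m * tau) ^ 2 := by rw [← this]; ring
      rw [e2]
      nlinarith [sq_nonneg (I + B), sq_nonneg (I - m * tau), sq_nonneg (B + m * tau)]
    have e3 : 3 * tau ^ 2 * m ^ 2 ≤ 3 * tau ^ 2 * (c₁ * X) :=
      mul_le_mul_of_nonneg_left em (by positivity)
    have e4 : lam * R ≤ lam * X := mul_le_mul_of_nonneg_left
      (by rw [hX]; nlinarith [sq_nonneg A, sq_nonneg B]) hlam.le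
    have e5 : B ^ 2 ≤ X := by rw [hX]; nlinarith [sq_nonneg A]
    nlinarith
  have eN : N ≤ M * X := by
    have e1 : s ^ 2 * lam ≤ c₂ * X * lam := mul_le_mul_of_nonneg_right es hlam.le
    have e2 : m ^ 2 * nu ≤ c₁ * X * nu := mul_le_mul_of_nonneg_right em hnu
    have e3 : R ≤ X := by rw [hX]; nlinarith [sq_nonneg A, sq_nonneg B]
    have e4 : 0 ≤ c₂ * X := by positivity
    rw [hM]
    nlinarith
  have es' : s ^ 2 ≤ M * X := es.trans (mul_le_mul_of_nonneg_right (by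
    rw [hM]
    have : 0 ≤ 3 * (1 + lam * c₂ + nu * c₁) := by positivity
    linarith) pX)
  have q1 : 1 / (40 * M) * N ≤ X / 40 := by
    rw [div_mul_eq_mul_div, one_mul, div_le_div_iff₀ (by positivity) (by norm_num)]
    linarith
  have q2 : -(4 * s * A) ≤ 160 * M * A ^ 2 + X / 40 := by
    have h5 : -(4 * s * A) ≤ 160 * M * A ^ 2 + s ^ 2 / (40 * M) := by
      have : 0 ≤ (80 * M * A + s) ^ 2 / (40 * M) := by positivity
      have e : (80 * M * A + s) ^ 2 / (40 * M)
          = 160 * M * A ^ 2 + 4 * s * A + s ^ 2 / (40 * M) := by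
        field_simp
        ring
      linarith
    have h6 : s ^ 2 / (40 * M) ≤ X / 40 := by
      rw [div_le_div_iff₀ (by positivity) (by norm_num)]
      linarith
    linarith
  have : 0 ≤ M * B ^ 2 := by positivity
  nlinarith [sq_nonneg A, sq_nonneg B]

/-- Coercivity on the half-line without boundary condition, with two orthogonality conditions. -/
theorem exists_coercive_Ioi :
    ∃ κ C : ℝ, 0 < κ ∧ 0 < C ∧ ∀ F F' : ℝ → ℝ, (∀ y, HasDerivAt F (F' y) y) → Continuous F' →
      MemLp F 2 (volume.restrict (Ioi 0)) → MemLp F' 2 (volume.restrict (Ioi 0)) →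
      κ * (∫ y in Ioi 0, F y ^ 2) - C * ((∫ y in Ioi 0, F y * sechProfile 5 y) ^ 2
          + (∫ y in Ioi 0, F y * critLam y) ^ 2)
        ≤ ∫ y in Ioi 0, (F' y ^ 2 + (15 * Real.tanh (2 * y) ^ 2 - 14) * F y ^ 2) := by
  obtain ⟨κ, C, hκ, hC, H⟩ := exists_coercive_const_of_shift
    (tau := ∫ y in Ioi 0, critKer y * critLam y) integral_critLam_sq_pos
    (integral_nonneg fun y => sq_nonneg _ : 0 ≤ ∫ y in Ioi 0, sechProfile 5 y ^ 2)
    (integral_nonneg fun y => sq_nonneg _ : 0 ≤ ∫ y in Ioi 0, critKer y ^ 2)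
  refine ⟨κ, C, hκ, hC, fun F F' hF cF' hF2 hF2' => ?_⟩
  obtain ⟨m, hm⟩ := exists_shift_coercive (-2 * F 0) hF cF' hF2 hF2' (by
    simp only [critLam, sechProfile_zero]
    ring)
  have mS := memLp_sechProfile_five.restrict (Ioi 0)
  have mL := memLp_critLam.restrict (Ioi 0)
  have h1 := sq_integral_shift_mul_le (-2 * F 0) m hF2 mS
  have h2 := sq_integral_shift_mul_le (-2 * F 0) m hF2 mL
  rw [integral_shift_mul _ _ hF2 mS, integral_critLam_mul_sechProfile,
    integral_critKer_mul_sechProfile, mul_zero, add_zero, mul_one_div] at h1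
  rw [integral_shift_mul _ _ hF2 mL] at h2
  simp_rw [← pow_two (critLam _)] at h2
  exact H _ _ m _ _ _ _ (integral_nonneg fun y => sq_nonneg _) h1 h2
    (integral_sq_le_shift _ m hF2) hm

/-- Coercivity on the half-line with the Dirichlet condition and one orthogonality condition. -/
theorem exists_coercive_Ioi_dirichlet :
    ∃ κ C : ℝ, 0 < κ ∧ 0 < C ∧ ∀ G G' : ℝ → ℝ, (∀ y, HasDerivAt G (G' y) y) → Continuous G' →
      MemLp G 2 (volume.restrict (Ioi 0)) → MemLp G' 2 (volume.restrict (Ioi 0)) → G 0 = 0 →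
      κ * (∫ y in Ioi 0, G y ^ 2) - C * (∫ y in Ioi 0, G y * (y * critLam y)) ^ 2
        ≤ ∫ y in Ioi 0, (G' y ^ 2 + (15 * Real.tanh (2 * y) ^ 2 - 14) * G y ^ 2) := by
  have hlam := integral_critLam_sq_pos
  have hmu : 0 ≤ ∫ y in Ioi 0, critKer y ^ 2 := integral_nonneg fun y => sq_nonneg _
  have hnu : 0 ≤ ∫ y in Ioi 0, (y * critLam y) ^ 2 := integral_nonneg fun y => sq_nonneg _
  set lam := ∫ y in Ioi 0, critLam y ^ 2 with hlam_def
  set mu := ∫ y in Ioi 0, critKer y ^ 2 with hmu_def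
  set nu := ∫ y in Ioi 0, (y * critLam y) ^ 2 with hnu_def
  set c := 3 + 6 * mu * (nu + 1) / lam ^ 2 with hc
  have pc : 0 < c := by positivity
  refine ⟨1 / (20 * c), 1, by positivity, one_pos, fun G G' hG cG' hG2 hG2' h0 => ?_⟩
  obtain ⟨m, hm⟩ := exists_shift_coercive 0 hG cG' hG2 hG2' (by rw [h0]; ring)
  have mY := memLp_mul_critLam.restrict (Ioi 0)
  have h1 := sq_integral_shift_mul_le 0 m hG2 mY
  have h2 := integral_sq_le_shift 0 m hG2
  rw [integral_shift_mul _ _ hG2 mY, integral_critKer_mul_mul_critLam, ← hnu_def, ← hlam_def] at h1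
  rw [← hmu_def, ← hlam_def] at h2
  have hR : 0 ≤ ∫ y in Ioi 0, (G y + 0 * critLam y - m * critKer y) ^ 2 :=
    integral_nonneg fun y => sq_nonneg _
  set R := ∫ y in Ioi 0, (G y + 0 * critLam y - m * critKer y) ^ 2
  set D := ∫ y in Ioi 0, G y * (y * critLam y)
  set N := ∫ y in Ioi 0, G y ^ 2
  set E := ∫ y in Ioi 0, (G' y ^ 2 + (15 * Real.tanh (2 * y) ^ 2 - 14) * G y ^ 2)
  have em : m ^ 2 ≤ 2 * (nu + 1) * (R + D ^ 2) / lam ^ 2 := by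
    rw [le_div_iff₀ (by positivity)]
    have : 0 ≤ nu * D ^ 2 := by positivity
    nlinarith [sq_nonneg (2 * D + m * lam)]
  have eN : N ≤ c * (R + D ^ 2) := by
    have := mul_le_mul_of_nonneg_right em hmu
    have e : c * (R + D ^ 2)
        = 3 * (R + D ^ 2) + 3 * (2 * (nu + 1) * (R + D ^ 2) / lam ^ 2 * mu) := by
      rw [hc]
      field_simp
      ring
    rw [e]
    nlinarith [sq_nonneg D]
  have q1 : 1 / (20 * c) * N ≤ (R + D ^ 2) / 20 := by
    rw [div_mul_eq_mul_div, one_mul, div_le_div_iff₀ (by positivity) (by norm_num)]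
    linarith
  nlinarith [sq_nonneg D]

/-! ### The estimate on the line at the critical exponent -/

theorem integral_eq_integral_Ioi_add {g : ℝ → ℝ} (hg : Integrable g) :
    ∫ y, g y = ∫ y in Ioi 0, (g y + g (-y)) := by
  have h := integral_comp_neg_Ioi 0 g
  rw [integral_add hg.integrableOn hg.comp_neg.integrableOn, h, neg_zero, add_comm,
    intervalIntegral.integral_Iic_add_Ioi hg.integrableOn hg.integrableOn]

theorem sechProfile_neg (p y : ℝ) : sechProfile p (-y) = sechProfile p y := by
  rw [sechProfile, sechProfile, mul_neg, Real.cosh_neg]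

theorem critLam_neg (y : ℝ) : critLam (-y) = critLam y := by
  rw [critLam, critLam, sechProfile_neg, mul_neg, Real.tanh_neg, neg_mul_neg]

theorem memLp_comp_neg {g : ℝ → ℝ} (hg : MemLp g 2) : MemLp (fun y => g (-y)) 2 :=
  hg.comp_measurePreserving (Measure.measurePreserving_neg volume)

theorem exists_coercive_L2 :
    ∃ κ C : ℝ, 0 < κ ∧ 0 < C ∧ ∀ f f' : ℝ → ℝ, (∀ y, HasDerivAt f (f' y) y) → Continuous f' →
      MemLp f 2 → MemLp f' 2 →
      κ * (∫ y, f y ^ 2) - C * ((∫ y, f y * sechProfile 5 y) ^ 2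
          + (∫ y, f y * critLam y) ^ 2 + (∫ y, f y * (y * critLam y)) ^ 2)
        ≤ ∫ y, (f' y ^ 2 + (15 * Real.tanh (2 * y) ^ 2 - 14) * f y ^ 2) := by
  obtain ⟨κ₁, C₁, hκ₁, hC₁, H₁⟩ := exists_coercive_Ioi
  obtain ⟨κ₂, C₂, hκ₂, hC₂, H₂⟩ := exists_coercive_Ioi_dirichlet
  refine ⟨min κ₁ κ₂, max C₁ C₂, lt_min hκ₁ hκ₂, lt_max_of_lt_left hC₁,
    fun f f' hf cf' hf2 hf2' => ?_⟩
  have hfn : ∀ y, HasDerivAt (fun y => f (-y)) (-f' (-y)) y := fun y =>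
    (HasDerivAt.comp y (hf (-y)) (hasDerivAt_neg y)).congr_deriv (by ring)
  have cfn : Continuous fun y => f' (-y) := cf'.comp continuous_neg
  have mfn := memLp_comp_neg hf2
  have mfn' := memLp_comp_neg hf2'
  have mF : MemLp (fun y => f y + f (-y)) 2 := hf2.add mfn
  have mF' : MemLp (fun y => f' y + -f' (-y)) 2 := hf2'.add mfn'.neg
  have mG : MemLp (fun y => f y - f (-y)) 2 := hf2.sub mfn
  have mG' : MemLp (fun y => f' y - -f' (-y)) 2 := hf2'.sub mfn'.neg
  have h₁ := H₁ (fun y => f y + f (-y)) (fun y => f' y + -f' (-y))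
    (fun y => (hf y).add (hfn y)) (cf'.add cfn.neg) (mF.restrict _) (mF'.restrict _)
  have h₂ := H₂ (fun y => f y - f (-y)) (fun y => f' y - -f' (-y))
    (fun y => (hf y).sub (hfn y)) (cf'.sub cfn.neg) (mG.restrict _) (mG'.restrict _) (by simp)
  have eN : (∫ y in Ioi 0, (f y + f (-y)) ^ 2) + (∫ y in Ioi 0, (f y - f (-y)) ^ 2)
      = 2 * ∫ y, f y ^ 2 := by
    rw [integral_eq_integral_Ioi_add hf2.integrable_sq, ← integral_const_mul,
      ← integral_add mF.integrable_sq.integrableOn mG.integrable_sq.integrableOn]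
    refine integral_congr_ae (Eventually.of_forall fun y => ?_)
    simp only
    ring
  have eE : (∫ y in Ioi 0, ((f' y + -f' (-y)) ^ 2
        + (15 * Real.tanh (2 * y) ^ 2 - 14) * (f y + f (-y)) ^ 2))
      + (∫ y in Ioi 0, ((f' y - -f' (-y)) ^ 2
        + (15 * Real.tanh (2 * y) ^ 2 - 14) * (f y - f (-y)) ^ 2))
      = 2 * ∫ y, (f' y ^ 2 + (15 * Real.tanh (2 * y) ^ 2 - 14) * f y ^ 2) := by
    rw [integral_eq_integral_Ioi_add (integrable_form hf2 hf2'), ← integral_const_mul,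
      ← integral_add (integrable_form mF mF').integrableOn (integrable_form mG mG').integrableOn]
    refine integral_congr_ae (Eventually.of_forall fun y => ?_)
    simp only [mul_neg, Real.tanh_neg, neg_sq]
    ring
  have eA : ∫ y in Ioi 0, (f y + f (-y)) * sechProfile 5 y = ∫ y, f y * sechProfile 5 y := by
    rw [integral_eq_integral_Ioi_add (hf2.integrable_mul memLp_sechProfile_five :
      Integrable fun y => f y * sechProfile 5 y)]
    refine integral_congr_ae (Eventually.of_forall fun y => ?_)
    simp only [sechProfile_neg]
    ring
  have eB : ∫ y in Ioi 0, (f y + f (-y)) * critLam y = ∫ y, f y * critLam y := by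
    rw [integral_eq_integral_Ioi_add (hf2.integrable_mul memLp_critLam :
      Integrable fun y => f y * critLam y)]
    refine integral_congr_ae (Eventually.of_forall fun y => ?_)
    simp only [critLam_neg]
    ring
  have eD : ∫ y in Ioi 0, (f y - f (-y)) * (y * critLam y) = ∫ y, f y * (y * critLam y) := by
    rw [integral_eq_integral_Ioi_add (hf2.integrable_mul memLp_mul_critLam :
      Integrable fun y => f y * (y * critLam y))]
    refine integral_congr_ae (Eventually.of_forall fun y => ?_)
    simp only [critLam_neg]
    ring
  rw [eA, eB] at h₁
  rw [eD] at h₂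
  have n₁ : 0 ≤ ∫ y in Ioi 0, (f y + f (-y)) ^ 2 := integral_nonneg fun y => sq_nonneg _
  have n₂ : 0 ≤ ∫ y in Ioi 0, (f y - f (-y)) ^ 2 := integral_nonneg fun y => sq_nonneg _
  have k₁ := mul_le_mul_of_nonneg_right (min_le_left κ₁ κ₂) n₁
  have k₂ := mul_le_mul_of_nonneg_right (min_le_right κ₁ κ₂) n₂
  have c₁ := mul_le_mul_of_nonneg_right (le_max_left C₁ C₂)
    (by positivity : 0 ≤ (∫ y, f y * sechProfile 5 y) ^ 2 + (∫ y, f y * critLam y) ^ 2)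
  have c₂ := mul_le_mul_of_nonneg_right (le_max_right C₁ C₂)
    (sq_nonneg (∫ y, f y * (y * critLam y)))
  have hN : min κ₁ κ₂ * (∫ y in Ioi 0, (f y + f (-y)) ^ 2)
      + min κ₁ κ₂ * (∫ y in Ioi 0, (f y - f (-y)) ^ 2) = min κ₁ κ₂ * (2 * ∫ y, f y ^ 2) := by
    rw [← eN]
    ring
  have cpos : 0 ≤ max C₁ C₂ * ((∫ y, f y * sechProfile 5 y) ^ 2
      + (∫ y, f y * critLam y) ^ 2 + (∫ y, f y * (y * critLam y)) ^ 2) :=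
    mul_nonneg (lt_max_of_lt_left hC₁).le (by positivity)
  nlinarith

theorem exists_coercive_H1 :
    ∃ κ C : ℝ, 0 < κ ∧ 0 < C ∧ ∀ f f' : ℝ → ℝ, (∀ y, HasDerivAt f (f' y) y) → Continuous f' →
      MemLp f 2 → MemLp f' 2 →
      κ * (∫ y, (f' y ^ 2 + f y ^ 2)) - C * ((∫ y, f y * sechProfile 5 y) ^ 2
          + (∫ y, f y * critLam y) ^ 2 + (∫ y, f y * (y * critLam y)) ^ 2)
        ≤ ∫ y, (f' y ^ 2 + (15 * Real.tanh (2 * y) ^ 2 - 14) * f y ^ 2) := by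
  obtain ⟨κ, C, hκ, hC, H⟩ := exists_coercive_L2
  refine ⟨κ / (κ + 15), C, by positivity, hC, fun f f' hf cf' hf2 hf2' => ?_⟩
  have h₁ := H f f' hf cf' hf2 hf2'
  have h₂ : (∫ y, f' y ^ 2) - 14 * (∫ y, f y ^ 2)
      ≤ ∫ y, (f' y ^ 2 + (15 * Real.tanh (2 * y) ^ 2 - 14) * f y ^ 2) := by
    rw [← integral_const_mul, ← integral_sub hf2'.integrable_sq (hf2.integrable_sq.const_mul 14)]
    refine integral_mono (hf2'.integrable_sq.sub (hf2.integrable_sq.const_mul 14))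
      (integrable_form hf2 hf2') fun y => ?_
    simp only
    nlinarith [mul_nonneg (sq_nonneg (Real.tanh (2 * y))) (sq_nonneg (f y))]
  rw [integral_add hf2'.integrable_sq hf2.integrable_sq]
  have hX : 0 ≤ (∫ y, f y * sechProfile 5 y) ^ 2
      + (∫ y, f y * critLam y) ^ 2 + (∫ y, f y * (y * critLam y)) ^ 2 := by positivity
  set X := (∫ y, f y * sechProfile 5 y) ^ 2
      + (∫ y, f y * critLam y) ^ 2 + (∫ y, f y * (y * critLam y)) ^ 2
  set N := ∫ y, f y ^ 2
  set D := ∫ y, f' y ^ 2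
  set E := ∫ y, (f' y ^ 2 + (15 * Real.tanh (2 * y) ^ 2 - 14) * f y ^ 2)
  rw [sub_le_iff_le_add, div_mul_eq_mul_div, div_le_iff₀ (by positivity)]
  have := mul_le_mul_of_nonneg_left h₂ hκ.le
  have : 0 ≤ κ * (C * X) := by positivity
  nlinarith

/-! ### The ground state near the critical exponent -/

theorem Qp_eq (p y : ℝ) : Qp p y = ((p + 1) / 2) ^ (1 / (p - 1)) * sechProfile p y := by
  rw [Qp, sechProfile, mul_div_right_comm]

theorem LamQp_eq {p : ℝ} (hp : 1 < p) (y : ℝ) :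
    LamQp p y = (2 / (p - 1) - y * Real.tanh ((p - 1) / 2 * y)) * Qp p y := by
  have h : Qp p = fun y => ((p + 1) / 2) ^ (1 / (p - 1)) * sechProfile p y := funext (Qp_eq p)
  rw [LamQp, h, ((hasDerivAt_sechProfile hp y).const_mul _).deriv]
  ring

theorem continuous_Qp {p : ℝ} (hp : 1 < p) : Continuous (Qp p) := by
  rw [show Qp p = fun y => ((p + 1) / 2) ^ (1 / (p - 1)) * sechProfile p y from funext (Qp_eq p)]
  exact (continuous_sechProfile hp).const_mul _

theorem continuous_LamQp {p : ℝ} (hp : 1 < p) : Continuous (LamQp p) := by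
  rw [show LamQp p = fun y => (2 / (p - 1) - y * Real.tanh ((p - 1) / 2 * y)) * Qp p y from
    funext (LamQp_eq hp)]
  exact (continuous_const.sub (continuous_id.mul (continuous_tanh_mul _))).mul (continuous_Qp hp)

theorem Qp_pos {p : ℝ} (hp : 1 < p) (y : ℝ) : 0 < Qp p y := by
  rw [Qp_eq]
  exact mul_pos (Real.rpow_pos_of_pos (by linarith) _) (sechProfile_pos p y)

theorem Qp_le {p : ℝ} (h5 : 5 ≤ p) (h6 : p ≤ 6) (y : ℝ) : Qp p y ≤ 7 / 2 * sechProfile p y := by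
  rw [Qp_eq]
  refine mul_le_mul_of_nonneg_right ?_ (sechProfile_pos p y).le
  calc ((p + 1) / 2) ^ (1 / (p - 1)) ≤ ((p + 1) / 2) ^ (1 : ℝ) :=
        Real.rpow_le_rpow_of_exponent_le (by linarith)
          (by rw [div_le_one (by linarith)]; linarith)
    _ ≤ 7 / 2 := by rw [Real.rpow_one]; linarith

theorem abs_mul_Qp_le {p a C y : ℝ} (h5 : 5 ≤ p) (h6 : p ≤ 6) (ha : |a| ≤ C * (1 + y ^ 2)) :
    |a * Qp p y| ≤ 7 / 2 * C * ((1 + y ^ 2) * sechProfile p y) := by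
  have hQ := Qp_pos (p := p) (by linarith) y
  rw [abs_mul, abs_of_pos hQ]
  calc |a| * Qp p y ≤ C * (1 + y ^ 2) * (7 / 2 * sechProfile p y) :=
        mul_le_mul ha (Qp_le h5 h6 y) hQ.le ((abs_nonneg a).trans ha)
    _ = _ := by ring

theorem abs_Qp_le {p : ℝ} (h5 : 5 ≤ p) (h6 : p ≤ 6) (y : ℝ) :
    |Qp p y| ≤ 7 * ((1 + y ^ 2) * sechProfile p y) := by
  have h := abs_mul_Qp_le (a := 1) (C := 2) (y := y) h5 h6 (by
    rw [abs_one]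
    nlinarith [sq_nonneg y])
  rw [one_mul] at h
  exact h.trans_eq (by ring)

theorem abs_two_div_sub_le {p : ℝ} (h5 : 5 ≤ p) (y : ℝ) :
    |2 / (p - 1) - y * Real.tanh ((p - 1) / 2 * y)| ≤ 1 / 2 + |y| := by
  have h1 : |2 / (p - 1)| ≤ 1 / 2 := by
    rw [abs_of_nonneg (by apply div_nonneg <;> linarith), div_le_div_iff₀ (by linarith) two_pos]
    linarith
  exact (abs_sub _ _).trans (add_le_add h1 (abs_mul_tanh_le _ _))

theorem abs_LamQp_le {p : ℝ} (h5 : 5 ≤ p) (h6 : p ≤ 6) (y : ℝ) :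
    |LamQp p y| ≤ 7 * ((1 + y ^ 2) * sechProfile p y) := by
  rw [LamQp_eq (by linarith)]
  refine (abs_mul_Qp_le (C := 2) h5 h6 ((abs_two_div_sub_le h5 y).trans ?_)).trans_eq (by ring)
  nlinarith [sq_abs y, sq_nonneg (|y| - 1)]

theorem abs_mul_LamQp_le {p : ℝ} (h5 : 5 ≤ p) (h6 : p ≤ 6) (y : ℝ) :
    |y * LamQp p y| ≤ 7 * ((1 + y ^ 2) * sechProfile p y) := by
  rw [LamQp_eq (by linarith), ← mul_assoc]
  refine (abs_mul_Qp_le (C := 2) h5 h6 ?_).trans_eq (by ring)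
  rw [abs_mul]
  refine (mul_le_mul_of_nonneg_left (abs_two_div_sub_le h5 y) (abs_nonneg y)).trans ?_
  nlinarith [sq_abs y, sq_nonneg (|y| - 1)]

theorem continuousAt_Qp (y : ℝ) : ContinuousAt (fun p => Qp p y) 5 := by
  unfold Qp
  have h : ContinuousAt (fun p : ℝ => p - 1) 5 := by fun_prop
  refine ContinuousAt.mul (ContinuousAt.rpow (by fun_prop) ?_ (Or.inl (by norm_num)))
    (ContinuousAt.rpow ?_ ?_ (Or.inl (Real.cosh_pos _).ne'))
  · exact continuousAt_const.div h (by norm_num)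
  · exact Real.continuous_cosh.continuousAt.comp (by fun_prop)
  · exact (continuousAt_const.div h (by norm_num)).neg

theorem continuousAt_LamQp (y : ℝ) : ContinuousAt (fun p => LamQp p y) 5 := by
  have h : ContinuousAt (fun p : ℝ => p - 1) 5 := by fun_prop
  have ht : ContinuousAt (fun p => Real.tanh ((p - 1) / 2 * y)) 5 := by
    have := (continuous_tanh_mul 1).continuousAt (x := (5 - 1) / 2 * y)
    simp only [one_mul] at this
    exact ContinuousAt.comp (f := fun p : ℝ => (p - 1) / 2 * y) this (by fun_prop)
  have := ((continuousAt_const (y := (2 : ℝ))).div h (by norm_num)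
    |>.sub (continuousAt_const (y := y) |>.mul ht)).mul (continuousAt_Qp y)
  refine this.congr ?_
  filter_upwards [lt_mem_nhds (show (1 : ℝ) < 5 by norm_num)] with p hp
  exact (LamQp_eq hp y).symm

theorem tendsto_integral_sq_sub {g : ℝ → ℝ → ℝ} {C : ℝ}
    (hg : ∀ p, 1 < p → Continuous (g p))
    (hC : ∀ p, 5 ≤ p → p ≤ 6 → ∀ y, |g p y| ≤ C * ((1 + y ^ 2) * sechProfile p y))
    (hp : ∀ y, ContinuousAt (fun p => g p y) 5) :
    Tendsto (fun p => ∫ y, (g 5 y - g p y) ^ 2) (𝓝[≥] 5) (𝓝 0) := by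
  have hI : ∀ᶠ p in 𝓝[≥] (5 : ℝ), p ∈ Ico (5 : ℝ) 6 := Ico_mem_nhdsGE (by norm_num)
  have h0 : (0 : ℝ) = ∫ y, (g 5 y - g 5 y) ^ 2 := by simp
  rw [h0]
  refine tendsto_integral_filter_of_dominated_convergence
    (fun y => 4 * (C ^ 2 * (2 * 32 ^ 4) ^ 2) * (1 + y ^ 2)⁻¹) ?_ ?_
    (integrable_inv_one_add_sq.const_mul _) ?_
  · filter_upwards [hI] with p hp
    exact (((hg 5 (by norm_num)).sub (hg p (by linarith [hp.1]))).pow 2).aestronglyMeasurable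
  · filter_upwards [hI] with p hp
    refine Eventually.of_forall fun y => ?_
    have h1 := sq_le_of_abs_le_sechProfile (by norm_num) (hC 5 le_rfl (by norm_num) y)
    have h2 := sq_le_of_abs_le_sechProfile (by linarith [hp.1]) (hC p hp.1 hp.2.le y)
    rw [Real.norm_eq_abs, abs_of_nonneg (sq_nonneg _)]
    nlinarith [sq_nonneg (g 5 y + g p y)]
  · refine Eventually.of_forall fun y => ?_
    exact ((continuousAt_const.sub (hp y)).pow 2).tendsto.mono_left nhdsWithin_le_nhds

theorem mul_Qp_rpow {p : ℝ} (hp : 1 < p) (y : ℝ) :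
    p * Qp p y ^ (p - 1) = p * (p + 1) / 2 * (1 - Real.tanh ((p - 1) / 2 * y) ^ 2) := by
  have hp' : p - 1 ≠ 0 := (sub_pos.2 hp).ne'
  have hc := Real.cosh_pos ((p - 1) / 2 * y)
  rw [Qp_eq, sechProfile, Real.mul_rpow (Real.rpow_nonneg (by linarith) _)
    (Real.rpow_nonneg hc.le _), ← Real.rpow_mul (by linarith), ← Real.rpow_mul hc.le,
    one_div_mul_cancel hp', Real.rpow_one, neg_mul, div_mul_cancel₀ _ hp', Real.rpow_neg hc.le,
    Real.rpow_two, Real.tanh_eq_sinh_div_cosh, div_pow, Real.sinh_sq]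
  field_simp
  ring

theorem mul_Qp_rpow_le {p : ℝ} (hp : 5 ≤ p) (y : ℝ) :
    p * Qp p y ^ (p - 1) ≤ 15 * (1 - Real.tanh (2 * y) ^ 2) + (p * (p + 1) / 2 - 15) := by
  rw [mul_Qp_rpow (by linarith)]
  have h : Real.tanh (2 * y) ^ 2 ≤ Real.tanh ((p - 1) / 2 * y) ^ 2 := by
    have e : ∀ x, Real.tanh x ^ 2 = 1 - (Real.cosh x ^ 2)⁻¹ := fun x => by
      have := Real.cosh_pos x
      rw [Real.tanh_eq_sinh_div_cosh, div_pow, Real.sinh_sq]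
      field_simp
    have hc : Real.cosh (2 * y) ≤ Real.cosh ((p - 1) / 2 * y) := by
      rw [Real.cosh_le_cosh, abs_mul, abs_mul]
      refine mul_le_mul_of_nonneg_right ?_ (abs_nonneg y)
      rw [abs_two, abs_of_nonneg] <;> linarith
    rw [e, e]
    gcongr
  have ha : 0 ≤ p * (p + 1) / 2 - 15 := by nlinarith
  nlinarith [sq_nonneg (Real.tanh ((p - 1) / 2 * y))]

/-- Coercivity at the critical exponent `p = 5`. -/
theorem exists_coercive_five :
    ∃ κ C : ℝ, 0 < κ ∧ 0 < C ∧ ∀ f f' : ℝ → ℝ, (∀ y, HasDerivAt f (f' y) y) → Continuous f' →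
      MemLp f 2 → MemLp f' 2 →
      κ * (∫ y, (f' y ^ 2 + f y ^ 2)) - C * ((∫ y, f y * Qp 5 y) ^ 2
          + (∫ y, f y * LamQp 5 y) ^ 2 + (∫ y, f y * (y * LamQp 5 y)) ^ 2)
        ≤ ∫ y, (f' y ^ 2 + (15 * Real.tanh (2 * y) ^ 2 - 14) * f y ^ 2) := by
  obtain ⟨κ, C, hκ, hC, H⟩ := exists_coercive_H1
  set c : ℝ := ((5 + 1) / 2) ^ (1 / (5 - 1) : ℝ) with hc
  have pc : 0 < c := Real.rpow_pos_of_pos (by norm_num) _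
  refine ⟨κ, C / c ^ 2, hκ, by positivity, fun f f' hf cf' hf2 hf2' => ?_⟩
  refine le_of_eq_of_le ?_ (H f f' hf cf' hf2 hf2')
  have eQ : ∀ y, Qp 5 y = c * sechProfile 5 y := Qp_eq 5
  have eL : ∀ y, LamQp 5 y = c * critLam y := fun y => by
    rw [LamQp_eq (by norm_num), eQ, critLam]
    norm_num
    ring
  have e1 : ∀ y, f y * Qp 5 y = c * (f y * sechProfile 5 y) := fun y => by rw [eQ]; ring
  have e2 : ∀ y, f y * LamQp 5 y = c * (f y * critLam y) := fun y => by rw [eL]; ring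
  have e3 : ∀ y, f y * (y * LamQp 5 y) = c * (f y * (y * critLam y)) := fun y => by
    rw [eL]; ring
  simp_rw [e1, e2, e3, integral_const_mul]
  field_simp

theorem sq_integral_mul_le_of_close {f w w₀ : ℝ → ℝ} {ε : ℝ} (hf : MemLp f 2) (hw : MemLp w 2)
    (hw₀ : MemLp w₀ 2) (h : ∫ y, (w₀ y - w y) ^ 2 ≤ ε) :
    (∫ y, f y * w₀ y) ^ 2 ≤ 2 * (∫ y, f y * w y) ^ 2 + 2 * (ε * ∫ y, f y ^ 2) := by
  have h1 := sq_integral_mul_le hf (hw₀.sub hw)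
  have e : ∫ y, f y * (w₀ - w) y = (∫ y, f y * w₀ y) - ∫ y, f y * w y := by
    have i₁ : Integrable fun y => f y * w₀ y := hf.integrable_mul hw₀
    have i₂ : Integrable fun y => f y * w y := hf.integrable_mul hw
    rw [← integral_sub i₁ i₂]
    exact integral_congr_ae (Eventually.of_forall fun y => mul_sub _ _ _)
  rw [e] at h1
  have h2 := h1.trans (mul_le_mul_of_nonneg_left h (integral_nonneg fun y => sq_nonneg _))
  nlinarith [sq_nonneg ((∫ y, f y * w₀ y) - 2 * ∫ y, f y * w y)]

theorem integral_form_sub_le {f f' : ℝ → ℝ} {p ε : ℝ} (hf : MemLp f 2) (hf' : MemLp f' 2)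
    (hp : 5 ≤ p) (hε : p * (p + 1) / 2 - 15 ≤ ε) :
    (∫ y, (f' y ^ 2 + (15 * Real.tanh (2 * y) ^ 2 - 14) * f y ^ 2)) - ε * ∫ y, f y ^ 2
      ≤ ∫ y, (f' y ^ 2 + f y ^ 2 - p * Qp p y ^ (p - 1) * f y ^ 2) := by
  have hV : Integrable fun y => p * Qp p y ^ (p - 1) * f y ^ 2 := by
    refine hf.integrable_sq.bdd_mul (c := p * (p + 1) / 2) ?_ (Eventually.of_forall fun y => ?_)
    · have : Continuous fun y => p * Qp p y ^ (p - 1) :=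
        ((continuous_Qp (by linarith)).rpow_const fun y => Or.inr (by linarith)).const_mul p
      exact this.aestronglyMeasurable
    · rw [mul_Qp_rpow (by linarith), Real.norm_eq_abs]
      have := Real.tanh_sq_lt_one ((p - 1) / 2 * y)
      have ha : 0 ≤ p * (p + 1) / 2 := by nlinarith
      rw [abs_of_nonneg (mul_nonneg ha (by linarith))]
      nlinarith [sq_nonneg (Real.tanh ((p - 1) / 2 * y))]
  rw [← integral_const_mul, ← integral_sub (integrable_form hf hf') (hf.integrable_sq.const_mul ε)]
  refine integral_mono ((integrable_form hf hf').sub (hf.integrable_sq.const_mul ε))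
    ((hf'.integrable_sq.add hf.integrable_sq).sub hV) fun y => ?_
  have := mul_le_mul_of_nonneg_right (mul_Qp_rpow_le hp y) (sq_nonneg (f y))
  have := mul_le_mul_of_nonneg_right hε (sq_nonneg (f y))
  simp only
  linarith

/-- Coercivity of the linearized operator under three orthogonality conditions
(Lemma A.1 of the paper, quadratic-form version). -/
theorem stmt_18 :
    ∃ pstar : ℝ, 5 < pstar ∧
      ∀ p : ℝ, 5 ≤ p → p < pstar →
        ∃ κ₀ : ℝ, 0 < κ₀ ∧
          ∀ f : ℝ → ℝ, ContDiff ℝ 1 f →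
            MeasureTheory.Integrable (fun y => (f y) ^ 2) →
            MeasureTheory.Integrable (fun y => (deriv f y) ^ 2) →
            (∫ y : ℝ, ((deriv f y) ^ 2 + (f y) ^ 2 - p * (Qp p y) ^ (p - 1) * (f y) ^ 2))
              ≥ κ₀ * (∫ y : ℝ, ((deriv f y) ^ 2 + (f y) ^ 2))
                - κ₀⁻¹ * ((∫ y : ℝ, f y * Qp p y) ^ 2
                    + (∫ y : ℝ, f y * LamQp p y) ^ 2
                    + (∫ y : ℝ, f y * (y * LamQp p y)) ^ 2) := by
  obtain ⟨κ, C, hκ, hC, H⟩ := exists_coercive_five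
  set ε := κ / (2 * (1 + 6 * C)) with hε_def
  have hε : 0 < ε := by positivity
  have hYc : ∀ p, 1 < p → Continuous fun y => y * LamQp p y := fun p hp =>
    continuous_id.mul (continuous_LamQp hp)
  have ev₁ := (tendsto_integral_sq_sub (fun p => continuous_Qp)
    (fun p => abs_Qp_le) continuousAt_Qp).eventually_le_const hε
  have ev₂ := (tendsto_integral_sq_sub (fun p => continuous_LamQp)
    (fun p => abs_LamQp_le) continuousAt_LamQp).eventually_le_const hε
  have ev₃ := (tendsto_integral_sq_sub hYc (fun p => abs_mul_LamQp_le)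
    fun y => continuousAt_const.mul (continuousAt_LamQp y)).eventually_le_const hε
  have ev₄ : ∀ᶠ p : ℝ in 𝓝[≥] 5, p * (p + 1) / 2 - 15 ≤ ε := by
    have : Tendsto (fun p : ℝ => p * (p + 1) / 2 - 15) (𝓝[≥] 5) (𝓝 (5 * (5 + 1) / 2 - 15)) :=
      (Continuous.tendsto (by fun_prop) 5).mono_left nhdsWithin_le_nhds
    exact this.eventually_le_const (by norm_num; exact hε)
  have ev₅ : ∀ᶠ p in 𝓝[≥] (5 : ℝ), p ∈ Ico (5 : ℝ) 6 := Ico_mem_nhdsGE (by norm_num)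
  obtain ⟨u, hu, hsub⟩ := mem_nhdsGE_iff_exists_Ico_subset.1
    (ev₁.and (ev₂.and (ev₃.and (ev₄.and ev₅))))
  refine ⟨u, hu, fun p h5 hpu => ?_⟩
  obtain ⟨h₁, h₂, h₃, h₄, -, h6⟩ := hsub ⟨h5, hpu⟩
  refine ⟨min (κ / 2) (1 / (2 * C)), by positivity, fun f hf hf2 hf2' => ?_⟩
  have cf' : Continuous (deriv f) := hf.continuous_deriv le_rfl
  have mf : MemLp f 2 :=
    (memLp_two_iff_integrable_sq hf.continuous.aestronglyMeasurable).2 hf2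
  have mf' : MemLp (deriv f) 2 :=
    (memLp_two_iff_integrable_sq cf'.aestronglyMeasurable).2 hf2'
  have mem : ∀ {q : ℝ}, 5 ≤ q → q ≤ 6 →
      MemLp (Qp q) 2 ∧ MemLp (LamQp q) 2 ∧ MemLp (fun y => y * LamQp q y) 2 := fun hq hq' =>
    ⟨memLp_two_of_abs_le_sechProfile (by linarith) (continuous_Qp (by linarith))
      (abs_Qp_le hq hq'),
    memLp_two_of_abs_le_sechProfile (by linarith) (continuous_LamQp (by linarith))
      (abs_LamQp_le hq hq'),
    memLp_two_of_abs_le_sechProfile (by linarith) (hYc _ (by linarith))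
      (abs_mul_LamQp_le hq hq')⟩
  obtain ⟨mQ, mL, mY⟩ := mem h5 h6.le
  obtain ⟨mQ₀, mL₀, mY₀⟩ := mem le_rfl (by norm_num : (5 : ℝ) ≤ 6)
  have k₁ := sq_integral_mul_le_of_close mf mQ mQ₀ h₁
  have k₂ := sq_integral_mul_le_of_close mf mL mL₀ h₂
  have k₃ := sq_integral_mul_le_of_close mf mY mY₀ h₃
  have k₄ := integral_form_sub_le mf mf' h5 h₄
  have k₅ := H f (deriv f) (fun y => (hf.differentiable one_ne_zero y).hasDerivAt) cf' mf mf'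
  have hN : ∫ y, f y ^ 2 ≤ ∫ y, (deriv f y ^ 2 + f y ^ 2) :=
    integral_mono hf2 (hf2'.add hf2) fun y => le_add_of_nonneg_left (sq_nonneg _)
  have hN₀ : 0 ≤ ∫ y, f y ^ 2 := integral_nonneg fun y => sq_nonneg _
  have hX : 0 ≤ (∫ y, f y * Qp p y) ^ 2 + (∫ y, f y * LamQp p y) ^ 2
      + (∫ y, f y * (y * LamQp p y)) ^ 2 := by positivity
  set N := ∫ y, f y ^ 2
  set M := ∫ y, (deriv f y ^ 2 + f y ^ 2)
  have hmin : 2 * C ≤ (min (κ / 2) (1 / (2 * C)))⁻¹ := by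
    rw [le_inv_comm₀ (by positivity) (by positivity), ← one_div]
    exact min_le_right _ _
  have q₁ := mul_le_mul_of_nonneg_right hmin hX
  have q₂ := mul_le_mul_of_nonneg_right (min_le_left (κ / 2) (1 / (2 * C))) (hN₀.trans hN)
  have q₃ : ε * (1 + 6 * C) = κ / 2 := by
    rw [hε_def]
    field_simp
  have q₄ : ε * (1 + 6 * C) * N ≤ κ / 2 * M := by
    rw [q₃]
    exact mul_le_mul_of_nonneg_left hN (by positivity)
  have q₅ := mul_le_mul_of_nonneg_left (add_le_add (add_le_add k₁ k₂) k₃) hC.le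
  rw [ge_iff_le]
  linarith
end
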